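/- arXiv:1802.01848 — 3 statements merged into one kernel-verified Lean document; each statement's English description precedes it below -/
import Mathlib

section
/- Let A be a finite-dimensional K-algebra, M a gen-finite A-module, and write E = N ⊕ Q where add N = gen(M) and Q is injective, chosen so that E is a basic cogenerator (E is the direct sum of all indecomposable modules in gen(M) together with any remaining indecomposable injective modules). Let B be the cogenerator-tilted algebra of E with special idempotent e and intermediate extension c : mod A → mod B. Then every B-submodule U of c(M) fits into a short exact sequence 0 → U → C₀ → C₁ → 0 with C₀, C₁ ∈ add c(E). Consequently Ext^i_B(U, c(M)/U) = 0 for all i > 0. -/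
/- Preliminary notions: `add`, `gen`, `cogen`, generators and cogenerators,
short exact sequences, basic modules, indecomposability. -/

noncomputable section

namespace GenFinitePaper

open Function

variable (R : Type) [Ring R]

/-- `M` lies in `add X`, i.e. `M` is a direct summand of a finite direct sum of copies of `X`. -/
def InAdd (X : Type) [AddCommGroup X] [Module R X]
    (M : Type) [AddCommGroup M] [Module R M] : Prop :=
  ∃ (n : ℕ) (i : M →ₗ[R] (Fin n → X)) (p : (Fin n → X) →ₗ[R] M), p.comp i = LinearMap.id

/-- `M` lies in `gen X`, i.e. `M` is an epimorphic image of a module in `add X`. -/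
def InGen (X : Type) [AddCommGroup X] [Module R X]
    (M : Type) [AddCommGroup M] [Module R M] : Prop :=
  ∃ (n : ℕ) (p : (Fin n → X) →ₗ[R] M), Surjective p

/-- `M` lies in `cogen X`, i.e. `M` embeds into a module in `add X`. -/
def InCogen (X : Type) [AddCommGroup X] [Module R X]
    (M : Type) [AddCommGroup M] [Module R M] : Prop :=
  ∃ (n : ℕ) (i : M →ₗ[R] (Fin n → X)), Injective i

/-- `E` is a generator for `mod R`: `R ∈ add E`. -/
def IsGenerator (E : Type) [AddCommGroup E] [Module R E] : Prop :=
  InAdd R E R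

/-- `E` is a cogenerator for `mod R`: every finitely generated (equivalently, over a
finite-dimensional algebra, finite-dimensional) module embeds into a module in `add E`. -/
def IsCogenerator (E : Type) [AddCommGroup E] [Module R E] : Prop :=
  ∀ (M : Type) [AddCommGroup M] [Module R M], Module.Finite R M → InCogen R E M

/-- A short exact sequence `0 → X → Y → Z → 0` of modules, given by a pair of composable
linear maps. -/
def IsShortExact {X Y Z : Type} [AddCommGroup X] [Module R X] [AddCommGroup Y] [Module R Y]
    [AddCommGroup Z] [Module R Z] (f : X →ₗ[R] Y) (g : Y →ₗ[R] Z) : Prop :=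
  Injective f ∧ Surjective g ∧ Exact f g

/-- A module is basic if it has no repeated indecomposable direct summands; equivalently
(by Krull--Remak--Schmidt) no nonzero module `X` is such that `X ⊕ X` is a direct summand. -/
def IsBasic (M : Type) [AddCommGroup M] [Module R M] : Prop :=
  ∀ (X Y : Type) [AddCommGroup X] [Module R X] [AddCommGroup Y] [Module R Y],
    Nonempty (M ≃ₗ[R] ((X × X) × Y)) → Subsingleton X

/-- A module is indecomposable if it is nonzero and admits no nontrivial idempotent
endomorphism. -/
def Indecomposable (M : Type) [AddCommGroup M] [Module R M] : Prop :=
  Nontrivial M ∧ ∀ φ : M →ₗ[R] M, φ.comp φ = φ → φ = 0 ∨ φ = LinearMap.id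

end GenFinitePaper
/- K-linear duality: the dual of the regular module, duals of modules over endomorphism
rings, and Hom-modules over endomorphism rings. -/

namespace GenFinitePaper

open Function

variable (K : Type) [Field K]

/-- `D R = Hom_K(R, K)`, the `K`-linear dual of a `K`-algebra `R`, viewed as a left
`R`-module via `(r • f) x = f (x * r)`. -/
def RegularDual (R : Type) [Ring R] [Algebra K R] : Type := R →ₗ[K] K

namespace RegularDual

variable (R : Type) [Ring R] [Algebra K R]

instance : AddCommGroup (RegularDual K R) := inferInstanceAs (AddCommGroup (R →ₗ[K] K))

instance : Module K (RegularDual K R) := inferInstanceAs (Module K (R →ₗ[K] K))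

/-- The action of `R` on its `K`-linear dual, by `(r • f) x = f (x * r)`. -/
def actHom : R →+* Module.End K (R →ₗ[K] K) where
  toFun r := (LinearMap.mulRight K r).lcomp K K
  map_one' := by ext f x; simp
  map_mul' r s := by ext f x; simp [mul_assoc]
  map_zero' := by ext f x; simp
  map_add' r s := by ext f x; simp [mul_add]

instance : Module R (RegularDual K R) :=
  Module.compHom (R →ₗ[K] K) (actHom K R)

lemma smul_def (r : R) (f : RegularDual K R) :
    r • f = (f : R →ₗ[K] K).comp (LinearMap.mulRight K r) := rfl

end RegularDual

/-- `D M = Hom_K(M, K)`, the `K`-linear dual of a module `M` over a `K`-algebra `R`,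
viewed as a left module over `End_R(M)ᵒᵖ` via `(φᵒᵖ • f) = f ∘ φ`. -/
def ModuleDual (R : Type) [Ring R] [Algebra K R] (M : Type) [AddCommGroup M] [Module R M]
    [Module K M] [IsScalarTower K R M] : Type := M →ₗ[K] K

namespace ModuleDual

variable (R : Type) [Ring R] [Algebra K R] (M : Type) [AddCommGroup M] [Module R M]
  [Module K M] [IsScalarTower K R M]

instance : AddCommGroup (ModuleDual K R M) := inferInstanceAs (AddCommGroup (M →ₗ[K] K))

instance : Module K (ModuleDual K R M) := inferInstanceAs (Module K (M →ₗ[K] K))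

/-- The action of `End_R(M)ᵒᵖ` on `Hom_K(M, K)` by precomposition. -/
def actHom : (Module.End R M)ᵐᵒᵖ →+* Module.End K (M →ₗ[K] K) where
  toFun φ := (LinearMap.restrictScalars K φ.unop).lcomp K K
  map_one' := by ext f x; rfl
  map_mul' φ ψ := by ext f x; rfl
  map_zero' := by ext f x; simp
  map_add' φ ψ := by ext f x; simp

instance : Module (Module.End R M)ᵐᵒᵖ (ModuleDual K R M) :=
  Module.compHom (M →ₗ[K] K) (actHom K R M)

lemma smul_def (φ : (Module.End R M)ᵐᵒᵖ) (f : ModuleDual K R M) :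
    φ • f = (f : M →ₗ[K] K).comp (LinearMap.restrictScalars K φ.unop) := rfl

end ModuleDual

/-- `Hom_R(E, N)` viewed as a left module over `Γ = End_R(E)ᵒᵖ` via `(φᵒᵖ • g) = g ∘ φ`. -/
def HomOp (R : Type) [Ring R] (E : Type) [AddCommGroup E] [Module R E]
    (N : Type) [AddCommGroup N] [Module R N] : Type := E →ₗ[R] N

namespace HomOp

variable (R : Type) [Ring R] (E : Type) [AddCommGroup E] [Module R E]
  (N : Type) [AddCommGroup N] [Module R N]

instance : AddCommGroup (HomOp R E N) := inferInstanceAs (AddCommGroup (E →ₗ[R] N))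

/-- The action of `End_R(E)ᵒᵖ` on `Hom_R(E, N)` by precomposition. -/
def actHom : (Module.End R E)ᵐᵒᵖ →+* Module.End ℤ (E →ₗ[R] N) where
  toFun φ :=
    { toFun := fun g => (g : E →ₗ[R] N).comp φ.unop
      map_add' := fun g h => LinearMap.add_comp _ _ _
      map_smul' := fun n g => LinearMap.smul_comp n g φ.unop }
  map_one' := by ext g x; rfl
  map_mul' φ ψ := by ext g x; rfl
  map_zero' := by ext g x; simp
  map_add' φ ψ := by ext g x; simp

instance : Module (Module.End R E)ᵐᵒᵖ (HomOp R E N) :=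
  Module.compHom (E →ₗ[R] N) (actHom R E N)

lemma smul_def (φ : (Module.End R E)ᵐᵒᵖ) (g : HomOp R E N) :
    φ • g = (g : E →ₗ[R] N).comp φ.unop := rfl

end HomOp

end GenFinitePaper

namespace GenFinitePaper

/-- Unfold a `RegularDual` element to a linear map. -/
def RegularDual.toLin (K : Type) [Field K] (R : Type) [Ring R] [Algebra K R]
    (f : RegularDual K R) : R →ₗ[K] K := f

/-- Unfold a `ModuleDual` element to a linear map. -/
def ModuleDual.toLin (K : Type) [Field K] (R : Type) [Ring R] [Algebra K R]
    (M : Type) [AddCommGroup M] [Module R M] [Module K M] [IsScalarTower K R M]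
    (f : ModuleDual K R M) : M →ₗ[K] K := f

/-- Unfold a `HomOp` element to a linear map. -/
def HomOp.toLin (R : Type) [Ring R] (E : Type) [AddCommGroup E] [Module R E]
    (N : Type) [AddCommGroup N] [Module R N] (g : HomOp R E N) : E →ₗ[R] N := g

end GenFinitePaper
/- Tilting and cotilting modules, and special (co)tilting modules. -/

namespace GenFinitePaper

open Function

variable (Γ : Type) [Ring Γ]

/-- A (classical) tilting module:
(T1) projective dimension at most 1;
(T2) no self-extensions (every short exact sequence `0 → T → X → T → 0` splits);
(T3) an exact sequence `0 → Γ → T₀ → T₁ → 0` with `T₀, T₁ ∈ add T`. -/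
structure IsTilting (T : Type) [AddCommGroup T] [Module Γ T] : Prop where
  pdim_le_one : ∃ (P₁ P₀ : Type) (_ : AddCommGroup P₁) (_ : Module Γ P₁)
      (_ : AddCommGroup P₀) (_ : Module Γ P₀) (f : P₁ →ₗ[Γ] P₀) (g : P₀ →ₗ[Γ] T),
      Module.Projective Γ P₁ ∧ Module.Projective Γ P₀ ∧ IsShortExact Γ f g
  rigid : ∀ (X : Type) [AddCommGroup X] [Module Γ X], ∀ (f : T →ₗ[Γ] X) (g : X →ₗ[Γ] T),
      IsShortExact Γ f g → ∃ r : X →ₗ[Γ] T, r.comp f = LinearMap.id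
  coresolves : ∃ (T₀ T₁ : Type) (_ : AddCommGroup T₀) (_ : Module Γ T₀)
      (_ : AddCommGroup T₁) (_ : Module Γ T₁) (f : Γ →ₗ[Γ] T₀) (g : T₀ →ₗ[Γ] T₁),
      InAdd Γ T T₀ ∧ InAdd Γ T T₁ ∧ IsShortExact Γ f g

/-- A `P`-special tilting module, for `P` a projective module: a tilting module `T` with
`P ∈ add T` such that the module `T₀` in (T3) can be chosen in `add P`. -/
structure IsSpecialTilting (P : Type) [AddCommGroup P] [Module Γ P]
    (T : Type) [AddCommGroup T] [Module Γ T] : Prop where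
  isTilting : IsTilting Γ T
  mem_add : InAdd Γ T P
  coresolves_special : ∃ (T₀ T₁ : Type) (_ : AddCommGroup T₀) (_ : Module Γ T₀)
      (_ : AddCommGroup T₁) (_ : Module Γ T₁) (f : Γ →ₗ[Γ] T₀) (g : T₀ →ₗ[Γ] T₁),
      InAdd Γ P T₀ ∧ InAdd Γ T T₁ ∧ IsShortExact Γ f g

variable (K : Type) [Field K] [Algebra K Γ]

/-- A (classical) cotilting module:
(C1) injective dimension at most 1;
(C2) no self-extensions;
(C3) an exact sequence `0 → C1 → C0 → DΓ → 0` with `C0, C1 ∈ add C`,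
where `DΓ` is the `K`-linear dual of the regular module. -/
structure IsCotilting (C : Type) [AddCommGroup C] [Module Γ C] : Prop where
  idim_le_one : ∃ (I0 I1 : Type) (_ : AddCommGroup I0) (_ : Module Γ I0)
      (_ : AddCommGroup I1) (_ : Module Γ I1) (f : C →ₗ[Γ] I0) (g : I0 →ₗ[Γ] I1),
      Module.Injective Γ I0 ∧ Module.Injective Γ I1 ∧ IsShortExact Γ f g
  rigid : ∀ (X : Type) [AddCommGroup X] [Module Γ X], ∀ (f : C →ₗ[Γ] X) (g : X →ₗ[Γ] C),
      IsShortExact Γ f g → ∃ r : X →ₗ[Γ] C, r.comp f = LinearMap.id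
  resolves : ∃ (C1 C0 : Type) (_ : AddCommGroup C1) (_ : Module Γ C1)
      (_ : AddCommGroup C0) (_ : Module Γ C0) (f : C1 →ₗ[Γ] C0)
      (g : C0 →ₗ[Γ] RegularDual K Γ),
      InAdd Γ C C1 ∧ InAdd Γ C C0 ∧ IsShortExact Γ f g

/-- A `Q`-special cotilting module, for `Q` an injective module: a cotilting module `C` with
`Q ∈ add C` such that the module `C0` in (C3) can be chosen in `add Q`. -/
structure IsSpecialCotilting (Q : Type) [AddCommGroup Q] [Module Γ Q]
    (C : Type) [AddCommGroup C] [Module Γ C] : Prop where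
  isCotilting : IsCotilting Γ K C
  mem_add : InAdd Γ C Q
  resolves_special : ∃ (C1 C0 : Type) (_ : AddCommGroup C1) (_ : Module Γ C1)
      (_ : AddCommGroup C0) (_ : Module Γ C0) (f : C1 →ₗ[Γ] C0)
      (g : C0 →ₗ[Γ] RegularDual K Γ),
      InAdd Γ Q C0 ∧ InAdd Γ C C1 ∧ IsShortExact Γ f g

end GenFinitePaper
/- Gen-finite and cogen-finite modules, representation-finite algebras. -/

namespace GenFinitePaper

open Function

variable (R : Type) [Ring R]

/-- A module `M` is gen-finite if `gen M = add E` for some finite-dimensional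
(equivalently, finitely generated) module `E`. -/
def GenFinite (M : Type) [AddCommGroup M] [Module R M] : Prop :=
  ∃ (E : Type) (_ : AddCommGroup E) (_ : Module R E), Module.Finite R E ∧
    ∀ (N : Type) [AddCommGroup N] [Module R N], (InGen R M N ↔ InAdd R E N)

/-- A module `M` is cogen-finite if `cogen M = add E` for some finite-dimensional
module `E`; here `cogen M` is taken inside finite-dimensional modules. -/
def CogenFinite (M : Type) [AddCommGroup M] [Module R M] : Prop :=
  ∃ (E : Type) (_ : AddCommGroup E) (_ : Module R E), Module.Finite R E ∧
    ∀ (N : Type) [AddCommGroup N] [Module R N], Module.Finite R N →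
      (InCogen R M N ↔ InAdd R E N)

/-- A ring is representation-finite if there is a single finite-dimensional module `X`
such that every finite-dimensional module lies in `add X`. -/
def RepFinite : Prop :=
  ∃ (X : Type) (_ : AddCommGroup X) (_ : Module R X), Module.Finite R X ∧
    ∀ (N : Type) [AddCommGroup N] [Module R N], Module.Finite R N → InAdd R X N

end GenFinitePaper
/- Vanishing of Ext groups, defined via splitting of extensions and dimension shifting. -/

namespace GenFinitePaper

open Function

variable (R : Type) [Ring R]

/-- `Ext¹_R(M, N) = 0`: every short exact sequence `0 → N → X → M → 0` splits. -/
def Ext1Vanish (M : Type) [AddCommGroup M] [Module R M]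
    (N : Type) [AddCommGroup N] [Module R N] : Prop :=
  ∀ (X : Type) [AddCommGroup X] [Module R X], ∀ (f : N →ₗ[R] X) (g : X →ₗ[R] M),
    IsShortExact R f g → ∃ s : M →ₗ[R] X, g.comp s = LinearMap.id

/-- `ExtVanishSucc R i M N` says `Ext^(i+1)_R(M, N) = 0`, defined by dimension shifting:
`Ext^(i+2)(M, N) ≅ Ext^(i+1)(Ω, N)` for any syzygy `0 → Ω → P → M → 0` with `P`
projective. -/
def ExtVanishSucc :
    ℕ → ∀ (M : Type) [AddCommGroup M] [Module R M] (N : Type) [AddCommGroup N] [Module R N],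
      Prop
  | 0 => fun M _ _ N _ _ => Ext1Vanish R M N
  | (i + 1) => fun M _ _ N _ _ =>
      ∀ (Ω P : Type) [AddCommGroup Ω] [Module R Ω] [AddCommGroup P] [Module R P],
        ∀ (f : Ω →ₗ[R] P) (g : P →ₗ[R] M), Module.Projective R P → IsShortExact R f g →
          ExtVanishSucc i Ω N

/-- `Ext^i_R(M, N) = 0` for all `i > 0`. -/
def ExtVanishAll (M : Type) [AddCommGroup M] [Module R M]
    (N : Type) [AddCommGroup N] [Module R N] : Prop :=
  ∀ i : ℕ, ExtVanishSucc R i M N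

end GenFinitePaper
/- Idempotent corners, stable and costable modules, and the intermediate extension functor
associated to an idempotent, characterised on objects. -/

namespace GenFinitePaper

open Function

variable (A B : Type) [Ring A] [Ring B]

/-- An identification of a ring `A` with the corner `eBe` of a ring `B` at an idempotent
`e` (the data of the multiplicative, additive map `A → B` landing in the corner). -/
structure CornerMap (e : B) where
  toHom : A →+ B
  map_mul : ∀ a b : A, toHom (a * b) = toHom a * toHom b
  map_one : toHom 1 = e
  mem_left : ∀ a : A, e * toHom a = toHom a
  mem_right : ∀ a : A, toHom a * e = toHom a

/-- A full corner identification: additionally bijective onto `eBe`. -/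
structure CornerIso (e : B) extends CornerMap A B e where
  inj : Function.Injective toHom
  surj : ∀ b : B, e * b = b → b * e = b → ∃ a : A, toHom a = b

variable {A B}

/-- The subgroup `eY` of a `B`-module `Y`, which is a module over `A ≅ eBe`. -/
def ePart {e : B} (φ : CornerMap A B e) (Y : Type) [AddCommGroup Y] [Module B Y] : Type :=
  {y : Y // e • y = y}

namespace ePart

variable {e : B} (φ : CornerMap A B e) (Y : Type) [AddCommGroup Y] [Module B Y]

/-- The underlying element of `Y`. -/
def val (y : ePart φ Y) : Y := Subtype.val y

lemma prop (y : ePart φ Y) : e • y.val = y.val := Subtype.property y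

/-- The `e`-part of a module, as an additive subgroup. -/
def addSubgroup : AddSubgroup Y where
  carrier := {y | e • y = y}
  add_mem' := fun {a b} ha hb => by
    simp only [Set.mem_setOf_eq] at *
    rw [smul_add, ha, hb]
  zero_mem' := smul_zero e
  neg_mem' := fun {a} ha => by
    simp only [Set.mem_setOf_eq] at *
    rw [smul_neg, ha]

instance : AddCommGroup (ePart φ Y) :=
  inferInstanceAs (AddCommGroup (addSubgroup (e := e) Y))

/-- The action of `A ≅ eBe` on `eY`. -/
def actHom : A →+* Module.End ℤ (ePart φ Y) where
  toFun a :=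
    { toFun := fun y => ⟨φ.toHom a • y.val, by rw [← mul_smul, φ.mem_left]⟩
      map_add' := fun y z => Subtype.ext (smul_add (φ.toHom a) y.val z.val)
      map_smul' := fun n y => Subtype.ext (by
        show φ.toHom a • (n • y).val = n • (φ.toHom a • y.val)
        have : (n • y).val = n • y.val := rfl
        rw [this, smul_comm]) }
  map_one' := by
    refine LinearMap.ext fun y => Subtype.ext ?_
    show φ.toHom 1 • y.val = y.val
    rw [φ.map_one]; exact y.prop
  map_mul' a b := by
    refine LinearMap.ext fun y => Subtype.ext ?_
    show φ.toHom (a * b) • y.val = φ.toHom a • φ.toHom b • y.val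
    rw [φ.map_mul, mul_smul]
  map_zero' := by
    refine LinearMap.ext fun y => Subtype.ext ?_
    show φ.toHom 0 • y.val = 0
    rw [map_zero, zero_smul]
  map_add' a b := by
    refine LinearMap.ext fun y => Subtype.ext ?_
    show φ.toHom (a + b) • y.val = φ.toHom a • y.val + φ.toHom b • y.val
    rw [map_add, add_smul]

instance : Module A (ePart φ Y) :=
  Module.compHom (ePart φ Y) (actHom φ Y)

lemma smul_def (a : A) (y : ePart φ Y) : (a • y).val = φ.toHom a • y.val := rfl

end ePart

variable (B)

/-- A `B`-module is stable (lies in `cogen D(eB)`) if it has no nonzero submodule killed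
by the idempotent `e`, i.e. `eBy ≠ 0` for `y ≠ 0`. -/
def IsStableMod (e : B) (Y : Type) [AddCommGroup Y] [Module B Y] : Prop :=
  ∀ y : Y, (∀ b : B, e • (b • y) = (0 : Y)) → y = 0

/-- A `B`-module is costable (lies in `gen Be`) if it is generated by `eY`:
`B • (e • Y) = Y`. -/
def IsCostableMod (e : B) (Y : Type) [AddCommGroup Y] [Module B Y] : Prop :=
  (⊤ : Submodule B Y) ≤ Submodule.span B {z : Y | ∃ w : Y, z = e • w}

variable {B}

/-- `Y` is (isomorphic to) the intermediate extension `c(M)` of the `A`-module `M` along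
the idempotent `e`: it is stable and costable (so lies in the image of the intermediate
extension functor), and `eY ≅ M` over `A ≅ eBe`.  This characterises `c(M)` uniquely up
to isomorphism. -/
def IsIntermediateExtension {e : B} (φ : CornerMap A B e)
    (M : Type) [AddCommGroup M] [Module A M]
    (Y : Type) [AddCommGroup Y] [Module B Y] : Prop :=
  IsCostableMod B e Y ∧ IsStableMod B e Y ∧ Nonempty (ePart φ Y ≃ₗ[A] M)

variable (B)

/-- The left ideal `Be`, for `e` an idempotent of `B`. -/
def leftCornerIdeal (e : B) : Submodule B B where
  carrier := {b | b * e = b}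
  add_mem' := fun {a b} ha hb => by
    simp only [Set.mem_setOf_eq] at *
    rw [add_mul, ha, hb]
  zero_mem' := zero_mul e
  smul_mem' := fun c {x} hx => by
    simp only [Set.mem_setOf_eq, smul_eq_mul] at *
    rw [mul_assoc, hx]

variable (K : Type) [Field K] [Algebra K B]

/-- The right ideal `eB`, for `e` an idempotent of `B`, as a `K`-subspace of `B`. -/
def rightCornerSubspace (e : B) : Submodule K B where
  carrier := {b | e * b = b}
  add_mem' := fun {a b} ha hb => by
    simp only [Set.mem_setOf_eq] at *
    rw [mul_add, ha, hb]
  zero_mem' := mul_zero e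
  smul_mem' := fun k {x} hx => by
    simp only [Set.mem_setOf_eq] at *
    rw [mul_smul_comm, hx]

/-- `D(eB) = Hom_K(eB, K)`, as a left `B`-module via `(c • f) x = f (x * c)`. -/
def CornerDual (e : B) : Type := rightCornerSubspace B K e →ₗ[K] K

namespace CornerDual

variable (e : B)

instance : AddCommGroup (CornerDual B K e) :=
  inferInstanceAs (AddCommGroup (rightCornerSubspace B K e →ₗ[K] K))

instance : Module K (CornerDual B K e) :=
  inferInstanceAs (Module K (rightCornerSubspace B K e →ₗ[K] K))

/-- Right multiplication by `c : B` on the right ideal `eB`, as a `K`-linear map. -/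
def rmul (c : B) : rightCornerSubspace B K e →ₗ[K] rightCornerSubspace B K e where
  toFun x := ⟨(x : B) * c, by
    have hx : e * (x : B) = (x : B) := x.2
    show e * ((x : B) * c) = (x : B) * c
    rw [← mul_assoc, hx]⟩
  map_add' x y := Subtype.ext (add_mul _ _ _)
  map_smul' k x := Subtype.ext (smul_mul_assoc k (x : B) c)

/-- The action of `B` on `D(eB)` by `(c • f) x = f (x * c)`. -/
def actHom : B →+* Module.End K (rightCornerSubspace B K e →ₗ[K] K) where
  toFun c := (rmul B K e c).lcomp K K
  map_one' := by
    ext f x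
    show f (rmul B K e 1 x) = f x
    congr 1
    exact Subtype.ext (mul_one _)
  map_mul' c d := by
    ext f x
    show f (rmul B K e (c * d) x) = f (rmul B K e d (rmul B K e c x))
    congr 1
    exact Subtype.ext (mul_assoc _ _ _).symm
  map_zero' := by
    ext f x
    show f (rmul B K e 0 x) = 0
    have h0 : rmul B K e 0 x = 0 := Subtype.ext (mul_zero _)
    rw [h0, map_zero]
  map_add' c d := by
    ext f x
    show f (rmul B K e (c + d) x) = f (rmul B K e c x) + f (rmul B K e d x)
    have h : rmul B K e (c + d) x = rmul B K e c x + rmul B K e d x :=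
      Subtype.ext (mul_add _ _ _)
    rw [h, map_add]

instance : Module B (CornerDual B K e) :=
  Module.compHom (rightCornerSubspace B K e →ₗ[K] K) (actHom B K e)

end CornerDual

end GenFinitePaper
/- The canonical corner identification of `A` with `e B e`, where `B` is the endomorphism
algebra of a module over `Γ = End_A(E)ᵒᵖ` having the dual `D E` as a direct summand, and
`e` is the idempotent given by projection onto that summand. -/

namespace GenFinitePaper

open Function

section Canon

variable (K A : Type) [Field K] [Ring A] [Algebra K A]
variable (E : Type) [AddCommGroup E] [Module A E] [Module K E] [IsScalarTower K A E]

/-- The action of `a : A` on `E`, as a `K`-linear map. -/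
def smulKLin (a : A) : E →ₗ[K] E where
  toFun x := a • x
  map_add' x y := smul_add a x y
  map_smul' k x := by
    simp only [RingHom.id_apply]
    rw [← algebraMap_smul A k x, ← mul_smul, ← Algebra.commutes k a, mul_smul,
      algebraMap_smul]

/-- The right action of `a : A` on `D E = Hom_K(E, K)` by precomposition, as an
endomorphism of the `Γ = End_A(E)ᵒᵖ`-module `D E`. -/
def dualAct (a : A) :
    ModuleDual K A E →ₗ[(Module.End A E)ᵐᵒᵖ] ModuleDual K A E where
  toFun f := (ModuleDual.toLin K A E f).comp (smulKLin K A E a)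
  map_add' f g := LinearMap.add_comp _ _ _
  map_smul' γ f := by
    simp only [RingHom.id_apply]
    refine LinearMap.ext fun x => ?_
    show ModuleDual.toLin K A E f (γ.unop (a • x)) = ModuleDual.toLin K A E f (a • γ.unop x)
    rw [map_smul]

lemma dualAct_one : dualAct K A E 1 = LinearMap.id := by
  refine LinearMap.ext fun f => ?_
  refine LinearMap.ext fun x => ?_
  show ModuleDual.toLin K A E f ((1 : A) • x) = ModuleDual.toLin K A E f x
  rw [one_smul]

lemma dualAct_mul (a b : A) :
    (dualAct K A E b).comp (dualAct K A E a) = dualAct K A E (a * b) := by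
  refine LinearMap.ext fun f => ?_
  refine LinearMap.ext fun x => ?_
  show ModuleDual.toLin K A E f (a • b • x) = ModuleDual.toLin K A E f ((a * b) • x)
  rw [mul_smul]

variable (T : Type) [AddCommGroup T] [Module (Module.End A E)ᵐᵒᵖ T]
variable (i₀ : ModuleDual K A E →ₗ[(Module.End A E)ᵐᵒᵖ] T)
variable (p₀ : T →ₗ[(Module.End A E)ᵐᵒᵖ] ModuleDual K A E)

/-- The canonical identification of `A` with the corner of
`B = End_Γ(T)ᵒᵖ` at the idempotent `e` given by projection onto a direct summand
`D E` of `T`, sending `a` to the endomorphism acting by `a` on this summand. -/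
def canonicalCornerMap (hsplit : p₀.comp i₀ = LinearMap.id) :
    CornerMap A (Module.End (Module.End A E)ᵐᵒᵖ T)ᵐᵒᵖ (MulOpposite.op (i₀.comp p₀)) where
  toHom :=
    { toFun := fun a => MulOpposite.op ((i₀.comp (dualAct K A E a)).comp p₀)
      map_zero' := by
        rw [← MulOpposite.op_zero]
        refine congrArg MulOpposite.op ?_
        refine LinearMap.ext fun t => ?_
        have h0 : dualAct K A E 0 (p₀ t) = 0 := by
          refine LinearMap.ext fun x => ?_
          show ModuleDual.toLin K A E (p₀ t) ((0 : A) • x) = 0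
          rw [zero_smul, map_zero]
        show i₀ (dualAct K A E 0 (p₀ t)) = 0
        rw [h0, map_zero]
      map_add' := fun a b => by
        rw [← MulOpposite.op_add]
        refine congrArg MulOpposite.op ?_
        refine LinearMap.ext fun t => ?_
        have h : dualAct K A E (a + b) (p₀ t) =
            dualAct K A E a (p₀ t) + dualAct K A E b (p₀ t) := by
          refine LinearMap.ext fun x => ?_
          show ModuleDual.toLin K A E (p₀ t) ((a + b) • x) =
            ModuleDual.toLin K A E (p₀ t) (a • x) + ModuleDual.toLin K A E (p₀ t) (b • x)
          rw [add_smul, map_add]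
        show i₀ (dualAct K A E (a + b) (p₀ t)) = i₀ (dualAct K A E a (p₀ t)) +
          i₀ (dualAct K A E b (p₀ t))
        rw [h, map_add] }
  map_mul := fun a b => by
    show MulOpposite.op _ = MulOpposite.op _ * MulOpposite.op _
    rw [← MulOpposite.op_mul]
    refine congrArg MulOpposite.op ?_
    have hsp : ∀ z, p₀ (i₀ z) = z := fun z => LinearMap.ext_iff.mp hsplit z
    refine LinearMap.ext fun t => ?_
    show i₀ (dualAct K A E (a * b) (p₀ t)) =
      i₀ (dualAct K A E b (p₀ (i₀ (dualAct K A E a (p₀ t)))))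
    rw [hsp, ← dualAct_mul]
    rfl
  map_one := by
    show MulOpposite.op _ = MulOpposite.op _
    refine congrArg MulOpposite.op ?_
    rw [dualAct_one]
    rfl
  mem_left := fun a => by
    show MulOpposite.op _ * MulOpposite.op _ = MulOpposite.op _
    rw [← MulOpposite.op_mul]
    refine congrArg MulOpposite.op ?_
    have hsp : ∀ z, p₀ (i₀ z) = z := fun z => LinearMap.ext_iff.mp hsplit z
    refine LinearMap.ext fun t => ?_
    show i₀ (dualAct K A E a (p₀ (i₀ (p₀ t)))) = i₀ (dualAct K A E a (p₀ t))
    rw [hsp]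
  mem_right := fun a => by
    show MulOpposite.op _ * MulOpposite.op _ = MulOpposite.op _
    rw [← MulOpposite.op_mul]
    refine congrArg MulOpposite.op ?_
    have hsp : ∀ z, p₀ (i₀ z) = z := fun z => LinearMap.ext_iff.mp hsplit z
    refine LinearMap.ext fun t => ?_
    show i₀ (p₀ (i₀ (dualAct K A E a (p₀ t)))) = i₀ (dualAct K A E a (p₀ t))
    rw [hsp]

end Canon

end GenFinitePaper

namespace GenFinitePaper

open Function

section ExtensionLifting

variable {R : Type} [Ring R]

/-- If `Ext¹(M, N) = 0`, then a map into `N` from the kernel of an epimorphism onto `M` extends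
along the inclusion of this kernel. -/
lemma Ext1Vanish.exists_extension {M N : Type} [AddCommGroup M] [Module R M] [AddCommGroup N]
    [Module R N] (hMN : Ext1Vanish R M N) {X Y : Type} [AddCommGroup X] [Module R X]
    [AddCommGroup Y] [Module R Y] {f : X →ₗ[R] Y} {g : Y →ₗ[R] M} (hfg : IsShortExact R f g)
    (h : X →ₗ[R] N) : ∃ h' : Y →ₗ[R] N, ∀ x, h' (f x) = h x := by
  obtain ⟨hf, hg, hex⟩ := hfg
  let S : Submodule R (N × Y) := LinearMap.range (LinearMap.prod h (-f))
  let ι : N →ₗ[R] (N × Y) ⧸ S := S.mkQ ∘ₗ LinearMap.inl R N Y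
  let π : (N × Y) ⧸ S →ₗ[R] M := S.liftQ (g ∘ₗ LinearMap.snd R N Y) (by
    rintro _ ⟨x, rfl⟩
    have : g (f x) = 0 := (hex (f x)).2 ⟨x, rfl⟩
    simp [this])
  have hπ : ∀ z, π (S.mkQ z) = g z.2 := fun z => by simp [π]
  have hSE : IsShortExact R ι π := by
    refine ⟨?_, ?_, ?_⟩
    · rw [injective_iff_map_eq_zero]
      intro n hn
      have hn' : ((n, 0) : N × Y) ∈ S := by
        simpa [ι, Submodule.Quotient.mk_eq_zero] using hn
      obtain ⟨x, hx⟩ := hn'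
      have h1 : h x = n := congrArg Prod.fst hx
      have h2 : -f x = 0 := congrArg Prod.snd hx
      have hx0 : x = 0 := hf (by rw [map_zero, ← neg_eq_zero, h2])
      rw [← h1, hx0, map_zero]
    · intro m
      obtain ⟨y, rfl⟩ := hg m
      exact ⟨S.mkQ (0, y), hπ _⟩
    · intro z
      obtain ⟨⟨n, y⟩, rfl⟩ := S.mkQ_surjective z
      rw [hπ]
      constructor
      · intro hy
        obtain ⟨x, rfl⟩ := (hex y).1 hy
        refine ⟨n + h x, ?_⟩
        refine (Submodule.Quotient.eq S).2 ⟨x, ?_⟩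
        simp
      · rintro ⟨n', hn'⟩
        rw [← hπ (n, y), ← hn']
        simp [ι, π]
  obtain ⟨s, hs⟩ := hMN _ ι π hSE
  have hs' : ∀ m, π (s m) = m := fun m => LinearMap.ext_iff.mp hs m
  have hker : ∀ y, S.mkQ (0, y) - s (g y) ∈ LinearMap.range ι := fun y =>
    (hSE.2.2 _).1 (by rw [map_sub, hs', hπ, sub_self])
  let ιe := LinearEquiv.ofInjective ι hSE.1
  let k : Y →ₗ[R] LinearMap.range ι :=
    (S.mkQ ∘ₗ LinearMap.inr R N Y - s ∘ₗ g).codRestrict (LinearMap.range ι) hker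
  refine ⟨ιe.symm.toLinearMap ∘ₗ k, fun x => ?_⟩
  have : k (f x) = ιe (h x) := by
    refine Subtype.ext ?_
    have h0 : g (f x) = 0 := (hex (f x)).2 ⟨x, rfl⟩
    have h1 : S.mkQ (0, f x) - s (g (f x)) = S.mkQ (h x, 0) := by
      rw [h0, map_zero, sub_zero]
      refine (Submodule.Quotient.eq S).2 ⟨-x, ?_⟩
      simp
    exact h1
  simp [this]

/-- If all maps from kernels of epimorphisms onto `M` into `N` extend, then `Ext¹(M, N) = 0`. -/
lemma ext1Vanish_of_exists_extension {M N : Type} [AddCommGroup M] [Module R M] [AddCommGroup N]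
    [Module R N]
    (H : ∀ (Y : Type) [AddCommGroup Y] [Module R Y] (f : N →ₗ[R] Y) (g : Y →ₗ[R] M),
      IsShortExact R f g → ∃ h' : Y →ₗ[R] N, ∀ x, h' (f x) = x) : Ext1Vanish R M N := by
  intro Y _ _ f g hfg
  obtain ⟨r, hr⟩ := H Y f g hfg
  obtain ⟨hf, hg, hex⟩ := hfg
  choose σ hσ using hg
  have key : ∀ y m, g y = m → σ m - f (r (σ m)) = y - f (r y) := by
    intro y m hy
    obtain ⟨n, hn⟩ := (hex (σ m - y)).1 (by rw [map_sub, hσ, hy, sub_self])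
    have h1 : σ m = y + f n := by rw [hn]; abel
    rw [h1, map_add, hr, map_add]
    abel
  refine ⟨{ toFun := fun m => σ m - f (r (σ m)), map_add' := ?_, map_smul' := ?_ }, ?_⟩
  · intro m m'
    rw [key (σ m + σ m') (m + m') (by rw [map_add, hσ, hσ])]
    simp only [map_add]
    abel
  · intro a m
    rw [key (a • σ m) (a • m) (by rw [map_smul, hσ])]
    simp [smul_sub]
  · ext m
    have : g (f (r (σ m))) = 0 := (hex _).2 ⟨_, rfl⟩
    simp [hσ, this]

/-- If `Ext¹(M, N) = 0`, then maps out of `M` lift along epimorphisms with kernel `N`. -/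
lemma Ext1Vanish.exists_lift {M N : Type} [AddCommGroup M] [Module R M] [AddCommGroup N]
    [Module R N] (hMN : Ext1Vanish R M N) {Y Z : Type} [AddCommGroup Y] [Module R Y]
    [AddCommGroup Z] [Module R Z] {f : N →ₗ[R] Y} {g : Y →ₗ[R] Z} (hfg : IsShortExact R f g)
    (h : M →ₗ[R] Z) : ∃ h' : M →ₗ[R] Y, ∀ m, g (h' m) = h m := by
  obtain ⟨hf, hg, hex⟩ := hfg
  let S : Submodule R (Y × M) :=
    LinearMap.ker (g ∘ₗ LinearMap.fst R Y M - h ∘ₗ LinearMap.snd R Y M)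
  have hS : ∀ z : Y × M, z ∈ S ↔ g z.1 = h z.2 := fun z => by simp [S, sub_eq_zero]
  have hgf : ∀ n, g (f n) = 0 := fun n => (hex _).2 ⟨n, rfl⟩
  let ι : N →ₗ[R] S := (LinearMap.inl R Y M ∘ₗ f).codRestrict S fun n => by
    rw [hS]; simp [hgf]
  let π : S →ₗ[R] M := LinearMap.snd R Y M ∘ₗ S.subtype
  have hSE : IsShortExact R ι π := by
    refine ⟨?_, ?_, ?_⟩
    · intro n n' hn
      exact hf (congrArg (fun z : S => z.1.1) hn)
    · intro m
      obtain ⟨y, hy⟩ := hg (h m)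
      exact ⟨⟨(y, m), (hS _).2 hy⟩, rfl⟩
    · rintro ⟨⟨y, m⟩, hz⟩
      rw [hS] at hz
      constructor
      · intro (hm : m = 0)
        subst hm
        obtain ⟨n, rfl⟩ := (hex y).1 (by simpa using hz)
        exact ⟨n, rfl⟩
      · rintro ⟨n, hn⟩
        exact (congrArg (fun z : S => z.1.2) hn).symm
  obtain ⟨s, hs⟩ := hMN _ ι π hSE
  refine ⟨LinearMap.fst R Y M ∘ₗ S.subtype ∘ₗ s, fun m => ?_⟩
  have h1 := (hS _).1 (s m).2
  have h2 : (s m).1.2 = m := LinearMap.ext_iff.mp hs m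
  rw [h2] at h1
  exact h1

/-- If maps out of `M` lift along all epimorphisms with kernel `N`, then `Ext¹(M, N) = 0`. -/
lemma ext1Vanish_of_exists_lift {M N : Type} [AddCommGroup M] [Module R M] [AddCommGroup N]
    [Module R N]
    (H : ∀ (Y : Type) [AddCommGroup Y] [Module R Y] (f : N →ₗ[R] Y) (g : Y →ₗ[R] M),
      IsShortExact R f g → ∃ h' : M →ₗ[R] Y, ∀ m, g (h' m) = m) : Ext1Vanish R M N := by
  intro Y _ _ f g hfg
  obtain ⟨s, hs⟩ := H Y f g hfg
  exact ⟨s, LinearMap.ext hs⟩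

/-- Membership in `add X` in terms of components. -/
lemma inAdd_iff {X M : Type} [AddCommGroup X] [Module R X] [AddCommGroup M] [Module R M] :
    InAdd R X M ↔ ∃ (n : ℕ) (a : Fin n → M →ₗ[R] X) (c : Fin n → X →ₗ[R] M),
      ∀ m, ∑ k, c k (a k m) = m := by
  constructor
  · rintro ⟨n, i, p, hpi⟩
    refine ⟨n, fun k => LinearMap.proj k ∘ₗ i, fun k => p ∘ₗ LinearMap.single R (fun _ => X) k,
      fun m => ?_⟩
    have h1 : p (i m) = m := LinearMap.ext_iff.mp hpi m
    simp only [LinearMap.comp_apply, LinearMap.proj_apply]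
    rw [← map_sum]
    simp only [LinearMap.single_apply]
    rw [Finset.univ_sum_single, h1]
  · rintro ⟨n, a, c, h⟩
    exact ⟨n, LinearMap.pi a, LinearMap.lsum R (fun _ => X) ℕ c, LinearMap.ext fun m => by
      simp [h]⟩

lemma InAdd.refl (X : Type) [AddCommGroup X] [Module R X] : InAdd R X X :=
  inAdd_iff.2 ⟨1, fun _ => LinearMap.id, fun _ => LinearMap.id, fun m => by simp⟩

lemma InAdd.trans {X Y Z : Type} [AddCommGroup X] [Module R X] [AddCommGroup Y] [Module R Y]
    [AddCommGroup Z] [Module R Z] (hXY : InAdd R X Y) (hYZ : InAdd R Y Z) : InAdd R X Z := by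
  obtain ⟨n, i, p, hpi⟩ := hXY
  obtain ⟨m, i', p', hpi'⟩ := hYZ
  let e : (Fin (m * n) → X) ≃ₗ[R] (Fin m → Fin n → X) :=
    (LinearEquiv.funCongrLeft R X finProdFinEquiv).trans (LinearEquiv.curry R X (Fin m) (Fin n))
  refine ⟨m * n, e.symm.toLinearMap ∘ₗ i.compLeft (Fin m) ∘ₗ i',
    p' ∘ₗ p.compLeft (Fin m) ∘ₗ e.toLinearMap, LinearMap.ext fun z => ?_⟩
  have h1 : ∀ y, p (i y) = y := fun y => LinearMap.ext_iff.mp hpi y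
  have h2 : p' (i' z) = z := LinearMap.ext_iff.mp hpi' z
  have h3 : p.compLeft (Fin m) (i.compLeft (Fin m) (i' z)) = i' z := by
    ext k
    simp [h1]
  simp only [LinearMap.comp_apply, LinearEquiv.coe_coe, LinearEquiv.apply_symm_apply, h3, h2,
    LinearMap.id_apply]

/-- `Ext¹(M, -)` vanishes on `add X` if it vanishes on `X`. -/
lemma Ext1Vanish.of_inAdd_right {M X N : Type} [AddCommGroup M] [Module R M] [AddCommGroup X]
    [Module R X] [AddCommGroup N] [Module R N] (hMX : Ext1Vanish R M X) (hN : InAdd R X N) :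
    Ext1Vanish R M N := by
  obtain ⟨n, a, c, hac⟩ := inAdd_iff.1 hN
  refine ext1Vanish_of_exists_extension fun Y _ _ f g hfg => ?_
  choose h' hh' using fun k => hMX.exists_extension hfg (a k)
  exact ⟨∑ k, c k ∘ₗ h' k, fun x => by simp [hh', hac]⟩

/-- `Ext¹(-, N)` vanishes on `add X` if it vanishes on `X`. -/
lemma Ext1Vanish.of_inAdd_left {M X N : Type} [AddCommGroup M] [Module R M] [AddCommGroup X]
    [Module R X] [AddCommGroup N] [Module R N] (hXN : Ext1Vanish R X N) (hM : InAdd R X M) :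
    Ext1Vanish R M N := by
  obtain ⟨n, a, c, hac⟩ := inAdd_iff.1 hM
  refine ext1Vanish_of_exists_lift fun Y _ _ f g hfg => ?_
  choose h' hh' using fun k => hXN.exists_lift hfg (c k)
  exact ⟨∑ k, h' k ∘ₗ a k, fun x => by simp [hh', hac]⟩

lemma InGen.of_surjective {X M M' : Type} [AddCommGroup X] [Module R X] [AddCommGroup M]
    [Module R M] [AddCommGroup M'] [Module R M'] (hM : InGen R X M) (f : M →ₗ[R] M')
    (hf : Surjective f) : InGen R X M' := by
  obtain ⟨n, p, hp⟩ := hM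
  exact ⟨n, f ∘ₗ p, hf.comp hp⟩

lemma InGen.refl (X : Type) [AddCommGroup X] [Module R X] : InGen R X X :=
  ⟨1, LinearMap.proj 0, fun x => ⟨fun _ => x, rfl⟩⟩

lemma InGen.prod_pi {X M M' : Type} [AddCommGroup X] [Module R X] [AddCommGroup M] [Module R M]
    [AddCommGroup M'] [Module R M'] (hM : InGen R X M) (hM' : InGen R X M') (k : ℕ) :
    InGen R X (M × (Fin k → M')) := by
  obtain ⟨n, p, hp⟩ := hM
  obtain ⟨n', p', hp'⟩ := hM'
  let e : Fin n ⊕ (Fin k × Fin n') ≃ Fin (n + k * n') :=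
    (Equiv.sumCongr (Equiv.refl _) finProdFinEquiv).trans finSumFinEquiv
  refine ⟨n + k * n', LinearMap.prod (p ∘ₗ LinearMap.funLeft R X fun i => e (Sum.inl i))
    (LinearMap.pi fun j => p' ∘ₗ LinearMap.funLeft R X fun i => e (Sum.inr (j, i))), ?_⟩
  rintro ⟨m, m'⟩
  obtain ⟨x, rfl⟩ := hp m
  choose x' hx' using fun j => hp' (m' j)
  refine ⟨fun l => Sum.elim x (fun z => x' z.1 z.2) (e.symm l), Prod.ext ?_ (funext fun j => ?_)⟩
  · refine congrArg p (funext fun i => ?_)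
    simp [LinearMap.funLeft_apply]
  · refine Eq.trans (congrArg p' (funext fun i => ?_)) (hx' j)
    simp [LinearMap.funLeft_apply]

end ExtensionLifting

/-- A functional vanishing on the kernel of a linear map factors through it. -/
lemma exists_functional_comp_eq {K V W : Type} [Field K] [AddCommGroup V] [Module K V]
    [AddCommGroup W] [Module K W] (f : V →ₗ[K] W) (g : V →ₗ[K] K)
    (h : ∀ v, f v = 0 → g v = 0) : ∃ l : W →ₗ[K] K, ∀ v, l (f v) = g v := by
  obtain ⟨s, hs⟩ := f.rangeRestrict.exists_rightInverse_of_surjective f.range_rangeRestrict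
  obtain ⟨l, hl⟩ := LinearMap.exists_extend (g ∘ₗ s)
  refine ⟨l, fun v => ?_⟩
  have h1 : l (f v) = g (s (f.rangeRestrict v)) := LinearMap.ext_iff.mp hl (f.rangeRestrict v)
  have h2 : f (s (f.rangeRestrict v)) = f v :=
    congrArg Subtype.val (LinearMap.ext_iff.mp hs (f.rangeRestrict v))
  rw [h1, ← sub_eq_zero, ← map_sub]
  exact h _ (by rw [map_sub, h2, sub_self])

end GenFinitePaper

namespace GenFinitePaper

open Function

section Corner

variable {A B : Type} [Ring A] [Ring B] {e : B} (φ : CornerMap A B e)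

lemma CornerMap.idempotent (φ : CornerMap A B e) : e * e = e := by
  have h := φ.mem_left 1
  rwa [φ.map_one] at h

/-- The `A`-linear map `eY → eY'` induced by a `B`-linear map `Y → Y'`. -/
def ePart.map {Y Y' : Type} [AddCommGroup Y] [Module B Y] [AddCommGroup Y'] [Module B Y']
    (H : Y →ₗ[B] Y') : ePart φ Y →ₗ[A] ePart φ Y' where
  toFun y := ⟨H y.val, by rw [← map_smul, ePart.prop]⟩
  map_add' y z := Subtype.ext (map_add H y.val z.val)
  map_smul' a y := Subtype.ext (map_smul H (φ.toHom a) y.val)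

/-- The element `e • y` of `eY`. -/
def ePart.mk {Y : Type} [AddCommGroup Y] [Module B Y] (y : Y) : ePart φ Y :=
  ⟨e • y, by rw [← mul_smul, φ.idempotent]⟩

lemma ePart.mk_val {Y : Type} [AddCommGroup Y] [Module B Y] (y : Y) :
    (ePart.mk φ y).val = e • y := rfl

lemma ePart.map_surjective {Y Y' : Type} [AddCommGroup Y] [Module B Y] [AddCommGroup Y']
    [Module B Y'] (H : Y →ₗ[B] Y') (hH : Surjective H) : Surjective (ePart.map φ H) := by
  intro y'
  obtain ⟨y, hy⟩ := hH y'.val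
  refine ⟨ePart.mk φ y, Subtype.ext ?_⟩
  have : H (e • y) = y'.val := by rw [map_smul, hy, ePart.prop]
  exact this

/-- A map into a stable module is determined by its restriction to the `e`-part. -/
lemma IsStableMod.hom_ext {Y Y' : Type} [AddCommGroup Y] [Module B Y] [AddCommGroup Y']
    [Module B Y'] (hY' : IsStableMod B e Y') {H H' : Y →ₗ[B] Y'}
    (h : ∀ y : ePart φ Y, H y.val = H' y.val) (y : Y) : H y = H' y := by
  rw [← sub_eq_zero]
  refine hY' _ fun b => ?_
  have h1 := h (ePart.mk φ (b • y))
  rw [ePart.mk_val, map_smul, map_smul, map_smul, map_smul] at h1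
  rw [smul_sub, smul_sub, h1, sub_self]

/-- Every `A`-linear map `eY → eY'` extends to a `B`-linear map `Y → Y'` if `Y` is costable and
`Y'` is stable. -/
lemma exists_hom_of_ePart_hom (hφ : ∀ b, ∃ a, φ.toHom a = e * b * e) {Y Y' : Type}
    [AddCommGroup Y] [Module B Y] [AddCommGroup Y'] [Module B Y'] (hY : IsCostableMod B e Y)
    (hY' : IsStableMod B e Y') (h : ePart φ Y →ₗ[A] ePart φ Y') :
    ∃ H : Y →ₗ[B] Y', ∀ y : ePart φ Y, H y.val = (h y).val := by
  let G : (ePart φ Y →₀ B) →ₗ[B] Y := Finsupp.linearCombination B fun y => y.val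
  let G' : (ePart φ Y →₀ B) →ₗ[B] Y' := Finsupp.linearCombination B fun y => (h y).val
  have hG : Surjective G := by
    rw [← LinearMap.range_eq_top, eq_top_iff]
    refine hY.trans (Submodule.span_le.2 ?_)
    rintro _ ⟨w, rfl⟩
    exact ⟨Finsupp.single (ePart.mk φ w) 1, by simp [G, ePart.mk_val]⟩
  have key : ∀ (b : B) (l : ePart φ Y →₀ B),
      ∃ z : ePart φ Y, z.val = e • b • G l ∧ (h z).val = e • b • G' l := by
    intro b l
    induction l using Finsupp.induction_linear with
    | zero => exact ⟨0, by simp; rfl, by simp; rfl⟩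
    | add l l' hl hl' =>
      obtain ⟨z, hz, hz'⟩ := hl
      obtain ⟨w, hw, hw'⟩ := hl'
      refine ⟨z + w, ?_, ?_⟩
      · simp only [map_add, smul_add, ← hz, ← hw]; rfl
      · simp only [map_add, smul_add, ← hz', ← hw']; rfl
    | single y c =>
      obtain ⟨a, ha⟩ := hφ (b * c)
      refine ⟨a • y, ?_, ?_⟩
      · rw [ePart.smul_def, ha]
        simp only [G, Finsupp.linearCombination_single, mul_smul, y.prop]
      · rw [map_smul, ePart.smul_def, ha]
        simp only [G', Finsupp.linearCombination_single, mul_smul, (h y).prop]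
  have hle : LinearMap.ker G ≤ LinearMap.ker G' := by
    intro l hl
    rw [LinearMap.mem_ker] at hl ⊢
    refine hY' _ fun b => ?_
    obtain ⟨z, hz, hz'⟩ := key b l
    have hz0 : z = 0 := Subtype.ext (by
      show z.val = 0
      rw [hz, hl, smul_zero, smul_zero])
    rw [← hz', hz0, map_zero]
    rfl
  refine ⟨(LinearMap.ker G).liftQ G' hle ∘ₗ (G.quotKerEquivOfSurjective hG).symm.toLinearMap,
    fun y => ?_⟩
  have h1 : (G.quotKerEquivOfSurjective hG).symm y.val =
      (LinearMap.ker G).mkQ (Finsupp.single y 1) := by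
    rw [LinearEquiv.symm_apply_eq]
    simp [G]
  simp only [LinearMap.comp_apply, LinearEquiv.coe_coe, h1]
  simp [G']

/-- The intermediate extension sends `add E` to `add c(E)`. -/
lemma IsIntermediateExtension.inAdd (hφ : ∀ b, ∃ a, φ.toHom a = e * b * e) {E X : Type}
    [AddCommGroup E] [Module A E] [AddCommGroup X] [Module A X] (hX : InAdd A E X)
    {cE cX : Type} [AddCommGroup cE] [Module B cE] [AddCommGroup cX] [Module B cX]
    (hcE : IsIntermediateExtension φ E cE) (hcX : IsIntermediateExtension φ X cX) :
    InAdd B cE cX := by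
  obtain ⟨hE₁, hE₂, ⟨ψE⟩⟩ := hcE
  obtain ⟨hX₁, hX₂, ⟨ψX⟩⟩ := hcX
  obtain ⟨n, a, c, hac⟩ := inAdd_iff.1 hX
  choose a' ha' using fun k => exists_hom_of_ePart_hom φ hφ hX₁ hE₂
    (ψE.symm.toLinearMap ∘ₗ a k ∘ₗ ψX.toLinearMap)
  choose c' hc' using fun k => exists_hom_of_ePart_hom φ hφ hE₁ hX₂
    (ψX.symm.toLinearMap ∘ₗ c k ∘ₗ ψE.toLinearMap)
  refine inAdd_iff.2 ⟨n, a', c', fun x => ?_⟩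
  have h1 := hX₂.hom_ext φ (H := ∑ k, c' k ∘ₗ a' k) (H' := LinearMap.id) (fun y => ?_) x
  · simpa using h1
  · have h2 : ∑ k, ePart.map φ (c' k) (ePart.map φ (a' k) y) = y := by
      have h3 : ∀ k, ePart.map φ (c' k) (ePart.map φ (a' k) y) =
          ψX.symm (c k (a k (ψX y))) := by
        intro k
        refine Subtype.ext ?_
        have h4 := hc' k (ePart.map φ (a' k) y)
        have h5 : ePart.map φ (a' k) y = ψE.symm (a k (ψX y)) := Subtype.ext (ha' k y)
        simp only [LinearMap.comp_apply, LinearEquiv.coe_coe, h5,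
          LinearEquiv.apply_symm_apply] at h4
        rw [h5]
        exact h4
      simp only [h3, ← map_sum, hac, LinearEquiv.symm_apply_apply]
    have h6 : ∀ s : Finset (Fin n), (∑ k ∈ s, ePart.map φ (c' k) (ePart.map φ (a' k) y)).val =
        ∑ k ∈ s, c' k (a' k y.val) := by
      intro s
      induction s using Finset.cons_induction with
      | empty => simp; rfl
      | cons k s hk ih => rw [Finset.sum_cons, Finset.sum_cons, ← ih]; rfl
    have h7 := h6 Finset.univ
    rw [h2] at h7
    simp [← h7]

lemma IsCostableMod.map_mem_span {Y Z : Type} [AddCommGroup Y] [Module B Y] [AddCommGroup Z]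
    [Module B Z] (hY : IsCostableMod B e Y) (f : Y →ₗ[B] Z) (y : Y) :
    f y ∈ Submodule.span B {z : Z | ∃ w : Z, z = e • w} := by
  have h1 : f y ∈ (Submodule.span B {z : Y | ∃ w : Y, z = e • w}).map f :=
    ⟨y, hY trivial, rfl⟩
  rw [Submodule.map_span] at h1
  refine Submodule.span_mono ?_ h1
  rintro _ ⟨_, ⟨w, rfl⟩, rfl⟩
  exact ⟨f w, map_smul f e w⟩

lemma IsCostableMod.of_surjective {Y Z : Type} [AddCommGroup Y] [Module B Y] [AddCommGroup Z]
    [Module B Z] (hY : IsCostableMod B e Y) (f : Y →ₗ[B] Z) (hf : Surjective f) :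
    IsCostableMod B e Z := by
  intro z _
  obtain ⟨y, rfl⟩ := hf z
  exact hY.map_mem_span f y

lemma IsCostableMod.prod_pi {Y Z : Type} [AddCommGroup Y] [Module B Y] [AddCommGroup Z]
    [Module B Z] (hY : IsCostableMod B e Y) (hZ : IsCostableMod B e Z) (k : ℕ) :
    IsCostableMod B e (Y × (Fin k → Z)) := by
  rintro ⟨y, z⟩ -
  have h1 : (y, z) = LinearMap.inl B Y (Fin k → Z) y + ∑ i,
      (LinearMap.inr B Y (Fin k → Z) ∘ₗ LinearMap.single B (fun _ => Z) i) (z i) := by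
    simp only [LinearMap.comp_apply, ← map_sum]
    simp only [LinearMap.single_apply]
    rw [Finset.univ_sum_single]
    simp
  rw [h1]
  exact add_mem (hY.map_mem_span _ y) (sum_mem fun i _ => hZ.map_mem_span _ (z i))

lemma IsStableMod.of_injective {Y Z : Type} [AddCommGroup Y] [Module B Y] [AddCommGroup Z]
    [Module B Z] (hZ : IsStableMod B e Z) (f : Y →ₗ[B] Z) (hf : Injective f) :
    IsStableMod B e Y := by
  intro y hy
  refine hf ?_
  rw [map_zero]
  refine hZ _ fun b => ?_
  rw [← map_smul, ← map_smul, hy, map_zero]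

lemma IsStableMod.pi {ι Z : Type} [AddCommGroup Z] [Module B Z] (hZ : IsStableMod B e Z) :
    IsStableMod B e (ι → Z) :=
  fun _ hz => funext fun i => hZ _ fun b => congrFun (hz b) i

lemma IsStableMod.prod {Y Z : Type} [AddCommGroup Y] [Module B Y] [AddCommGroup Z]
    [Module B Z] (hY : IsStableMod B e Y) (hZ : IsStableMod B e Z) : IsStableMod B e (Y × Z) :=
  fun _ hz => Prod.ext (hY _ fun b => congrArg Prod.fst (hz b))
    (hZ _ fun b => congrArg Prod.snd (hz b))

/-- Projective modules are stable as soon as the regular module is. -/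
lemma IsStableMod.of_projective (hB : IsStableMod B e B) (P : Type) [AddCommGroup P] [Module B P]
    [Module.Projective B P] : IsStableMod B e P := by
  obtain ⟨s, hs⟩ := Module.projective_def'.1 ‹Module.Projective B P›
  have h1 : IsStableMod B e (P → B) := hB.pi
  refine h1.of_injective (Finsupp.lcoeFun ∘ₗ s) fun x y hxy => ?_
  have h2 : s x = s y := DFunLike.coe_injective hxy
  have h3 : ∀ x, Finsupp.linearCombination B id (s x) = x := fun x => LinearMap.ext_iff.mp hs x
  rw [← h3 x, h2, h3]

end Corner

end GenFinitePaper

namespace GenFinitePaper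

open Function MulOpposite

section TiltingData

variable {Γ T P : Type} [Ring Γ] [AddCommGroup T] [Module Γ T] [AddCommGroup P] [Module Γ P]

lemma op_smul_op_smul {Y : Type} [AddCommGroup Y] [Module (Module.End Γ T)ᵐᵒᵖ Y]
    (f g : Module.End Γ T) (y : Y) : op f • op g • y = op (g ∘ₗ f) • y := by
  rw [← mul_smul, ← op_mul]
  rfl

/-- A special tilting module `T` presented through an exact sequence
`0 → Γ → T₀ → T₁ → 0`, where `x₀ ∈ T₀` is the image of `1`, `T₀` is a summand of `Pᵐ` and `T₁`
is a summand of `Tⁿ`. -/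
structure TiltingData (Γ T P T₀ T₁ : Type) [Ring Γ] [AddCommGroup T] [Module Γ T]
    [AddCommGroup P] [Module Γ P] [AddCommGroup T₀] [Module Γ T₀] [AddCommGroup T₁]
    [Module Γ T₁] where
  m : ℕ
  n : ℕ
  a : Fin m → T₀ →ₗ[Γ] P
  c : Fin m → P →ₗ[Γ] T₀
  a' : Fin n → T₁ →ₗ[Γ] T
  c' : Fin n → T →ₗ[Γ] T₁
  x₀ : T₀
  q : T₀ →ₗ[Γ] T₁
  sum_c_a : ∀ x, ∑ i, c i (a i x) = x
  sum_c'_a' : ∀ x, ∑ k, c' k (a' k x) = x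
  q_x₀ : q x₀ = 0
  q_surjective : Surjective q
  exists_smul : ∀ z, q z = 0 → ∃ γ : Γ, γ • x₀ = z
  exists_extension : ∀ t : T, ∃ s : T₀ →ₗ[Γ] T, s x₀ = t
  exists_factor : ∀ s : T₀ →ₗ[Γ] T, s x₀ = 0 → ∃ r : T₁ →ₗ[Γ] T, s = r ∘ₗ q
  exists_lift : ∀ h : P →ₗ[Γ] T₁, ∃ h' : P →ₗ[Γ] T₀, h = q ∘ₗ h'
  one_mem : ∀ S : AddSubgroup (Module.End Γ T),
    (∀ (θ : T →ₗ[Γ] P) (h : P →ₗ[Γ] T), h ∘ₗ θ ∈ S) →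
    (∀ (β : T →ₗ[Γ] T₁) (γ : T₁ →ₗ[Γ] T), γ ∘ₗ β ∈ S) → LinearMap.id ∈ S

namespace TiltingData

variable {T₀ T₁ : Type} [AddCommGroup T₀] [Module Γ T₀] [AddCommGroup T₁] [Module Γ T₁]
  (D : TiltingData Γ T P T₀ T₁) (i₀ : P →ₗ[Γ] T) (p₀ : T →ₗ[Γ] P)

/-- The matrix over `Bᵒᵖ = End_Γ(T)` presenting `T` as a right `B`-module. -/
def entry (i : Fin D.m) (k : Fin D.n) : Module.End Γ T := D.a' k ∘ₗ D.q ∘ₗ D.c i ∘ₗ p₀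

variable {p₀} in
lemma sum_entry_smul_op {Y : Type} [AddCommGroup Y] [Module (Module.End Γ T)ᵐᵒᵖ Y]
    (r : T₁ →ₗ[Γ] T) (i : Fin D.m) (y : Y) :
    ∑ k, op (D.entry p₀ i k) • op (r ∘ₗ D.c' k) • y = op (r ∘ₗ D.q ∘ₗ D.c i ∘ₗ p₀) • y := by
  simp only [op_smul_op_smul]
  rw [← Finset.sum_smul, ← Finset.op_sum]
  congr 2
  ext t
  simp only [entry, LinearMap.sum_apply, LinearMap.comp_apply]
  rw [← map_sum, D.sum_c'_a']

variable {i₀ p₀} in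
/-- Solutions of the linear system `D.entry` in a stable module vanish after applying any map
through `T₁`. -/
lemma sum_smul_eq_zero {Y : Type} [AddCommGroup Y] [Module (Module.End Γ T)ᵐᵒᵖ Y]
    (hsplit : p₀ ∘ₗ i₀ = LinearMap.id) (hY : IsStableMod _ (op (i₀ ∘ₗ p₀)) Y) (y : Fin D.n → Y)
    (hy : ∀ i, ∑ k, op (D.entry p₀ i k) • y k = 0) (β : T →ₗ[Γ] T₁) :
    ∑ k, op (D.a' k ∘ₗ β) • y k = 0 := by
  refine hY _ fun b => ?_
  obtain ⟨f, rfl⟩ := op_surjective b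
  obtain ⟨h, hh⟩ := D.exists_lift (β ∘ₗ f ∘ₗ i₀)
  have hh' : ∀ x, β (f (i₀ x)) = D.q (h x) := fun x => LinearMap.ext_iff.mp hh x
  have hsp : ∀ x, p₀ (i₀ x) = x := fun x => LinearMap.ext_iff.mp hsplit x
  have h1 : ∑ i, op (i₀ ∘ₗ D.a i ∘ₗ h ∘ₗ p₀) • ∑ k, op (D.entry p₀ i k) • y k = 0 := by
    simp [hy]
  rw [← h1]
  simp only [Finset.smul_sum, op_smul_op_smul]
  rw [Finset.sum_comm]
  refine Finset.sum_congr rfl fun k _ => ?_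
  rw [← Finset.sum_smul, ← Finset.op_sum]
  congr 2
  ext t
  simp only [entry, LinearMap.sum_apply, LinearMap.comp_apply, hsp, hh']
  simp only [← map_sum]
  rw [D.sum_c_a]

variable (K : Type) [Field K] [Algebra K Γ] [Module K T] [IsScalarTower K Γ T]

section

variable {Y : Type} [AddCommGroup Y] [Module (Module.End Γ T)ᵐᵒᵖ Y]

/-- The functional on `Yᵐ` attached to a map `Y → DT`. -/
def functional (g : Y →ₗ[(Module.End Γ T)ᵐᵒᵖ] ModuleDual K Γ T) (w : Fin D.m → Y) : K :=
  ∑ k, ModuleDual.toLin K Γ T (g (w k)) (i₀ (D.a k D.x₀))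

lemma map_op_smul_toLin (g : Y →ₗ[(Module.End Γ T)ᵐᵒᵖ] ModuleDual K Γ T) (f : Module.End Γ T)
    (y : Y) (t : T) :
    ModuleDual.toLin K Γ T (g (op f • y)) t = ModuleDual.toLin K Γ T (g y) (f t) := by
  rw [map_smul]
  rfl

variable {i₀ p₀} in
lemma functional_eval (hsplit : p₀ ∘ₗ i₀ = LinearMap.id)
    (g : Y →ₗ[(Module.End Γ T)ᵐᵒᵖ] ModuleDual K Γ T) (s : T₀ →ₗ[Γ] T) (y : Y) :
    D.functional i₀ K g (fun i => op (s ∘ₗ D.c i ∘ₗ p₀) • y) =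
      ModuleDual.toLin K Γ T (g y) (s D.x₀) := by
  have hsp : ∀ x, p₀ (i₀ x) = x := fun x => LinearMap.ext_iff.mp hsplit x
  simp only [functional, map_op_smul_toLin, LinearMap.comp_apply, hsp]
  rw [← map_sum, ← map_sum, D.sum_c_a]

lemma functional_sum {ι : Type} (s : Finset ι)
    (g : Y →ₗ[(Module.End Γ T)ᵐᵒᵖ] ModuleDual K Γ T) (w : ι → Fin D.m → Y) :
    D.functional i₀ K g (fun i => ∑ l ∈ s, w l i) = ∑ l ∈ s, D.functional i₀ K g (w l) := by
  simp only [functional]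
  rw [Finset.sum_comm]
  refine Finset.sum_congr rfl fun k _ => ?_
  induction s using Finset.cons_induction with
  | empty => simp; rfl
  | cons l s hl ih => rw [Finset.sum_cons, Finset.sum_cons, ← ih, map_add]; rfl

variable (Y) [Module K Y] [IsScalarTower K (Module.End Γ T)ᵐᵒᵖ Y]

/-- The linear system with matrix `D.entry` on a `B`-module. -/
def system : (Fin D.n → Y) →ₗ[K] (Fin D.m → Y) :=
  LinearMap.pi fun i => ∑ k, Algebra.lsmul K K Y (op (D.entry p₀ i k)) ∘ₗ LinearMap.proj k

variable {Y}

lemma system_apply (y : Fin D.n → Y) (i : Fin D.m) :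
    D.system p₀ K Y y i = ∑ k, op (D.entry p₀ i k) • y k := by
  simp [system]

variable {i₀ p₀} in
lemma functional_system (hsplit : p₀ ∘ₗ i₀ = LinearMap.id)
    (g : Y →ₗ[(Module.End Γ T)ᵐᵒᵖ] ModuleDual K Γ T) (y : Fin D.n → Y) :
    D.functional i₀ K g (D.system p₀ K Y y) = 0 := by
  have h1 : D.system p₀ K Y y = fun i => ∑ k, op (D.entry p₀ i k) • y k :=
    funext fun i => D.system_apply p₀ K y i
  rw [h1, functional_sum]
  refine Finset.sum_eq_zero fun k _ => ?_
  have h2 := D.functional_eval K hsplit g (D.a' k ∘ₗ D.q) (y k)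
  rw [LinearMap.comp_apply, D.q_x₀, map_zero, map_zero] at h2
  exact h2

/-- A functional on `Yᵐ` vanishing on the image of the linear system comes from a map
`Y → DT`. -/
lemma exists_hom_of_functional (l : (Fin D.m → Y) →ₗ[K] K)
    (hl : ∀ y, l (D.system p₀ K Y y) = 0) :
    ∃ g : Y →ₗ[(Module.End Γ T)ᵐᵒᵖ] ModuleDual K Γ T, ∀ (y : Y) (s : T₀ →ₗ[Γ] T),
      ModuleDual.toLin K Γ T (g y) (s D.x₀) = l fun i => op (s ∘ₗ D.c i ∘ₗ p₀) • y := by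
  let ev : (T₀ →ₗ[Γ] T) → Y → Fin D.m → Y := fun s y i => op (s ∘ₗ D.c i ∘ₗ p₀) • y
  have ev_add : ∀ s s' y, ev (s + s') y = ev s y + ev s' y := fun s s' y => funext fun i => by
    simp only [ev, LinearMap.add_comp, op_add, add_smul, Pi.add_apply]
  have ev_smul : ∀ (k : K) s y, ev (k • s) y = k • ev s y := fun k s y => funext fun i => by
    simp only [ev, LinearMap.smul_comp, op_smul, smul_assoc, Pi.smul_apply]
  have ev_add' : ∀ s y y', ev s (y + y') = ev s y + ev s y' := fun s y y' => funext fun i => by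
    simp only [ev, smul_add, Pi.add_apply]
  have ev_op : ∀ s f y, ev s (op f • y) = ev (f ∘ₗ s) y := fun s f y => funext fun i => by
    simp only [ev, op_smul_op_smul]
    rfl
  have wd0 : ∀ s y, s D.x₀ = 0 → l (ev s y) = 0 := by
    intro s y hs
    obtain ⟨r, rfl⟩ := D.exists_factor s hs
    rw [← hl fun k => op (r ∘ₗ D.c' k) • y]
    congr 1
    funext i
    rw [system_apply, sum_entry_smul_op]
    rfl
  have wd : ∀ s s' y, s D.x₀ = s' D.x₀ → l (ev s y) = l (ev s' y) := by
    intro s s' y hs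
    have h1 : s = (s - s') + s' := by abel
    rw [h1, ev_add, map_add, wd0 (s - s') y (by rw [LinearMap.sub_apply, hs, sub_self]), zero_add]
  choose σ hσ using D.exists_extension
  let g₀ : Y → T →ₗ[K] K := fun y =>
    { toFun := fun t => l (ev (σ t) y)
      map_add' := fun t t' => by
        rw [← map_add, ← ev_add]
        exact wd _ _ _ (by rw [LinearMap.add_apply, hσ, hσ, hσ])
      map_smul' := fun k t => by
        rw [RingHom.id_apply, ← map_smul, ← ev_smul]
        exact wd _ _ _ (by rw [LinearMap.smul_apply, hσ, hσ]) }
  refine ⟨{ toFun := g₀, map_add' := fun y y' => ?_, map_smul' := fun b y => ?_ }, fun y s => ?_⟩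
  · refine LinearMap.ext fun t => ?_
    show l (ev (σ t) (y + y')) = l (ev (σ t) y) + l (ev (σ t) y')
    rw [ev_add', map_add]
  · obtain ⟨f, rfl⟩ := op_surjective b
    refine LinearMap.ext fun t => ?_
    show l (ev (σ t) (op f • y)) = l (ev (σ (f t)) y)
    rw [ev_op]
    exact wd _ _ _ (by rw [LinearMap.comp_apply, hσ, hσ])
  · exact wd _ _ _ (hσ _)

end

variable {i₀ p₀} {X : Type} [AddCommGroup X] [Module (Module.End Γ T)ᵐᵒᵖ X] [Module K X]
  [IsScalarTower K (Module.End Γ T)ᵐᵒᵖ X]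

/-- Maps `U → DT` from a submodule `U` of `X` with stable quotient extend to `X`. -/
lemma exists_extension_of_stable (D : TiltingData Γ T P T₀ T₁) (hsplit : p₀ ∘ₗ i₀ = LinearMap.id)
    (U : Submodule (Module.End Γ T)ᵐᵒᵖ X) (hU : IsStableMod _ (op (i₀ ∘ₗ p₀)) (X ⧸ U))
    (g : U →ₗ[(Module.End Γ T)ᵐᵒᵖ] ModuleDual K Γ T) :
    ∃ g' : X →ₗ[(Module.End Γ T)ᵐᵒᵖ] ModuleDual K Γ T, ∀ u : U, g' u = g u := by
  let ι : (Fin D.m → U) →ₗ[K] (Fin D.m → X) := (U.subtype.restrictScalars K).compLeft (Fin D.m)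
  let R := LinearMap.range (D.system p₀ K X)
  let lg : (Fin D.m → U) →ₗ[K] K :=
    ∑ k, LinearMap.comp
      { toFun := fun u : U => ModuleDual.toLin K Γ T (g u) (i₀ (D.a k D.x₀))
        map_add' := fun u u' => by rw [map_add]; rfl
        map_smul' := fun r u => by
          rw [← algebraMap_smul (Module.End Γ T)ᵐᵒᵖ r u, map_smul, RingHom.id_apply,
            smul_eq_mul]
          show ModuleDual.toLin K Γ T (g u) (r • _) = _
          rw [map_smul, smul_eq_mul]
          rfl } (LinearMap.proj k)
  have hlg : ∀ w, lg w = D.functional i₀ K g w := fun w => by simp [lg, functional]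
  obtain ⟨l, hl⟩ := exists_functional_comp_eq (R.mkQ ∘ₗ ι) lg (by
    intro v hv
    have hv' : ι v ∈ R := (Submodule.Quotient.mk_eq_zero R).1 hv
    obtain ⟨x, hx⟩ := hv'
    have hx' : ∀ i, ∑ k, op (D.entry p₀ i k) • x k = (v i : X) := fun i => by
      rw [← D.system_apply p₀ K, hx]
      rfl
    have h1 := D.sum_smul_eq_zero hsplit hU (fun k => U.mkQ (x k)) (fun i => by
      simp only [← map_smul, ← map_sum]
      rw [hx']
      simp)
    let u : Fin D.n → U := fun k => ⟨∑ j, op (D.a' j ∘ₗ D.c' k) • x j, by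
      have h2 := h1 (D.c' k)
      simp only [← map_smul, ← map_sum] at h2
      exact (Submodule.Quotient.mk_eq_zero U).1 h2⟩
    have h3 : v = D.system p₀ K U u := by
      funext i
      refine Subtype.ext ?_
      rw [← hx', system_apply]
      simp only [Submodule.coe_sum, Submodule.coe_smul, u, Finset.smul_sum]
      rw [Finset.sum_comm]
      refine Finset.sum_congr rfl fun j _ => ?_
      rw [sum_entry_smul_op]
      rfl
    rw [hlg, h3, D.functional_system K hsplit])
  obtain ⟨g', hg'⟩ := D.exists_hom_of_functional p₀ K (l ∘ₗ R.mkQ) (fun y => by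
    have : R.mkQ (D.system p₀ K X y) = 0 :=
      (Submodule.Quotient.mk_eq_zero _).2 ⟨y, rfl⟩
    rw [LinearMap.comp_apply, this, map_zero])
  refine ⟨g', fun u => LinearMap.ext fun t => ?_⟩
  obtain ⟨s, rfl⟩ := D.exists_extension t
  refine (hg' u s).trans ?_
  have h4 := hl fun i => op (s ∘ₗ D.c i ∘ₗ p₀) • u
  rw [hlg, D.functional_eval K hsplit] at h4
  exact h4

/-- If `X` is stable and all maps `U → DT` extend to `X`, then `X / U` is stable. -/
lemma quotient_stable (D : TiltingData Γ T P T₀ T₁) (hsplit : p₀ ∘ₗ i₀ = LinearMap.id)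
    (hX : IsStableMod _ (op (i₀ ∘ₗ p₀)) X) (U : Submodule (Module.End Γ T)ᵐᵒᵖ X)
    (hext : ∀ g : U →ₗ[(Module.End Γ T)ᵐᵒᵖ] ModuleDual K Γ T,
      ∃ g' : X →ₗ[(Module.End Γ T)ᵐᵒᵖ] ModuleDual K Γ T, ∀ u : U, g' u = g u) :
    IsStableMod _ (op (i₀ ∘ₗ p₀)) (X ⧸ U) := by
  intro z hz
  obtain ⟨x, rfl⟩ := U.mkQ_surjective z
  have hsp : ∀ x, p₀ (i₀ x) = x := fun x => LinearMap.ext_iff.mp hsplit x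
  have hP : ∀ h : P →ₗ[Γ] T, op (h ∘ₗ p₀) • x ∈ U := by
    intro h
    have h1 := hz (op (h ∘ₗ p₀))
    rw [← map_smul, ← map_smul, op_smul_op_smul] at h1
    have h2 : (h ∘ₗ p₀) ∘ₗ i₀ ∘ₗ p₀ = h ∘ₗ p₀ := by
      ext t
      simp [hsp]
    rw [h2] at h1
    exact (Submodule.Quotient.mk_eq_zero U).1 h1
  refine (Submodule.Quotient.mk_eq_zero U).2 ?_
  let S : AddSubgroup (Module.End Γ T) :=
    { carrier := {f | op f • x ∈ U}
      add_mem' := fun {f f'} hf hf' => by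
        show op (f + f') • x ∈ U
        rw [op_add, add_smul]
        exact U.add_mem hf hf'
      zero_mem' := by
        show op 0 • x ∈ U
        rw [op_zero, zero_smul]
        exact U.zero_mem
      neg_mem' := fun {f} hf => by
        show op (-f) • x ∈ U
        rw [op_neg, neg_smul]
        exact U.neg_mem hf }
  have hS : LinearMap.id ∈ S := by
    refine D.one_mem S (fun θ h => ?_) (fun β γ => ?_)
    · have h1 := U.smul_mem (op (i₀ ∘ₗ θ)) (hP h)
      rw [op_smul_op_smul] at h1
      have h2 : (h ∘ₗ p₀) ∘ₗ i₀ ∘ₗ θ = h ∘ₗ θ := by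
        ext t
        simp [hsp]
      rwa [h2] at h1
    · let y : Fin D.n → X := fun k => op (γ ∘ₗ D.c' k) • x
      have hy : ∀ i, D.system p₀ K X y i = op (γ ∘ₗ D.q ∘ₗ D.c i ∘ₗ p₀) • x := fun i => by
        rw [system_apply, sum_entry_smul_op]
      let w : Fin D.m → U := fun i => ⟨D.system p₀ K X y i, by
        rw [hy]
        exact hP (γ ∘ₗ D.q ∘ₗ D.c i)⟩
      have hw : w ∈ LinearMap.range (D.system p₀ K U) := by
        by_contra hw
        obtain ⟨l, hl, hle⟩ := Submodule.exists_le_ker_of_notMem hw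
        obtain ⟨g, hg⟩ := D.exists_hom_of_functional p₀ K l fun u => hle ⟨u, rfl⟩
        obtain ⟨g', hg'⟩ := hext g
        refine hl ?_
        have h1 : w = ∑ k, fun i => op ((i₀ ∘ₗ D.a k) ∘ₗ D.c i ∘ₗ p₀) • w k := by
          funext i
          rw [Finset.sum_apply]
          refine Subtype.ext ?_
          simp only [Submodule.coe_sum, Submodule.coe_smul, w, hy, op_smul_op_smul]
          rw [← Finset.sum_smul, ← Finset.op_sum]
          congr 2
          ext t
          simp only [LinearMap.sum_apply, LinearMap.comp_apply, hsp]
          simp only [← map_sum]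
          rw [D.sum_c_a]
        rw [h1, map_sum]
        simp only [← hg, ← hg']
        exact D.functional_system K hsplit g' y
      obtain ⟨u, hu⟩ := hw
      have h2 := D.sum_smul_eq_zero hsplit hX (fun k => y k - u k) (fun i => by
        simp only [smul_sub, Finset.sum_sub_distrib]
        rw [← D.system_apply p₀ K, sub_eq_zero]
        have h3 : (w i : X) = (D.system p₀ K U u i : X) := by rw [hu]
        rw [system_apply] at h3
        simpa [w] using h3) β
      simp only [smul_sub, Finset.sum_sub_distrib, sub_eq_zero] at h2
      have h4 : op (γ ∘ₗ β) • x = ∑ k, op (D.a' k ∘ₗ β) • y k := by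
        simp only [y, op_smul_op_smul]
        rw [← Finset.sum_smul, ← Finset.op_sum]
        congr 2
        ext t
        simp only [LinearMap.sum_apply, LinearMap.comp_apply]
        rw [← map_sum, D.sum_c'_a']
      show op (γ ∘ₗ β) • x ∈ U
      rw [h4, h2]
      exact sum_mem fun k _ => U.smul_mem _ (u k).2
  have h5 : op (LinearMap.id : Module.End Γ T) • x ∈ U := hS
  rwa [show (op (LinearMap.id : Module.End Γ T)) = 1 from rfl, one_smul] at h5

end TiltingData

end TiltingData

end GenFinitePaper

namespace GenFinitePaper

open Function MulOpposite

section HomGenerators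

variable (K : Type) [Field K] {R : Type} [Ring R] [Algebra K R] [Module.Finite K R]

lemma exists_hom_generators (X Y : Type) [AddCommGroup X] [Module R X] [Module.Finite R X]
    [AddCommGroup Y] [Module R Y] [Module K Y] [IsScalarTower K R Y] [Module.Finite K Y] :
    ∃ (n : ℕ) (h : Fin n → X →ₗ[R] Y), ∀ g : X →ₗ[R] Y, ∃ c : Fin n → K,
      ∀ x, g x = ∑ i, c i • h i x := by
  let : Module K X := Module.compHom X (algebraMap K R)
  have : IsScalarTower K R X := IsScalarTower.of_algebraMap_smul fun _ _ => rfl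
  have : Module.Finite K X := Module.Finite.trans R X
  have : Module.Finite K (X →ₗ[R] Y) := Module.Finite.of_injective
    (LinearMap.restrictScalarsₗ K R X Y K) (LinearMap.restrictScalars_injective K)
  obtain ⟨n, h, hh⟩ := Module.Finite.exists_fin (R := K) (M := X →ₗ[R] Y)
  refine ⟨n, h, fun g => ?_⟩
  have hg : g ∈ Submodule.span K (Set.range h) := by
    rw [hh]
    trivial
  obtain ⟨c, hc⟩ := (Submodule.mem_span_range_iff_exists_fun K).1 hg
  exact ⟨c, fun x => by rw [← hc]; simp⟩

end HomGenerators

section Tilting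

variable {R : Type} [Ring R]

lemma exists_factor_of_ker_le {X Y Z : Type} [AddCommGroup X] [Module R X] [AddCommGroup Y]
    [Module R Y] [AddCommGroup Z] [Module R Z] {q : X →ₗ[R] Y} (hq : Surjective q)
    (s : X →ₗ[R] Z) (hs : ∀ x, q x = 0 → s x = 0) : ∃ r : Y →ₗ[R] Z, ∀ x, r (q x) = s x := by
  refine ⟨(LinearMap.ker q).liftQ s hs ∘ₗ (q.quotKerEquivOfSurjective hq).symm.toLinearMap,
    fun x => ?_⟩
  have h : (q.quotKerEquivOfSurjective hq).symm (q x) = (LinearMap.ker q).mkQ x := by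
    rw [LinearEquiv.symm_apply_eq]
    rfl
  rw [LinearMap.comp_apply, LinearEquiv.coe_coe, h]
  rfl

lemma Ext1Vanish.of_surjective {M N L : Type} [AddCommGroup M] [Module R M] [AddCommGroup N]
    [Module R N] [AddCommGroup L] [Module R L] (hMN : Ext1Vanish R M N)
    {P₁ P₀ : Type} [AddCommGroup P₁] [Module R P₁] [AddCommGroup P₀] [Module R P₀]
    [Module.Projective R P₁] [Module.Projective R P₀] {f : P₁ →ₗ[R] P₀} {g : P₀ →ₗ[R] M}
    (hfg : IsShortExact R f g) (v : N →ₗ[R] L) (hv : Surjective v) : Ext1Vanish R M L := by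
  refine ext1Vanish_of_exists_lift fun Y _ _ ι π hιπ => ?_
  obtain ⟨hι, hπ, hex⟩ := hιπ
  obtain ⟨G, hG⟩ := Module.projective_lifting_property π g hπ
  have hG' : ∀ x, π (G x) = g x := fun x => LinearMap.ext_iff.mp hG x
  have hgf : ∀ x, g (f x) = 0 := fun x => (hfg.2.2 _).2 ⟨x, rfl⟩
  let ιe := LinearEquiv.ofInjective ι hι
  let k : P₁ →ₗ[R] L := ιe.symm.toLinearMap ∘ₗ (G ∘ₗ f).codRestrict (LinearMap.range ι)
    fun x => (hex _).1 (by rw [LinearMap.comp_apply, hG', hgf])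
  have hk : ∀ x, ι (k x) = G (f x) := fun x =>
    congrArg Subtype.val (ιe.apply_symm_apply ((G ∘ₗ f).codRestrict (LinearMap.range ι) _ x))
  obtain ⟨k', hk'⟩ := Module.projective_lifting_property v k hv
  obtain ⟨k'', hk''⟩ := hMN.exists_extension hfg k'
  let H : P₀ →ₗ[R] Y := G - ι ∘ₗ v ∘ₗ k''
  have hH : ∀ x, g x = 0 → H x = 0 := by
    intro x hx
    obtain ⟨y, rfl⟩ := (hfg.2.2 x).1 hx
    have h1 : v (k' y) = k y := LinearMap.ext_iff.mp hk' y
    simp only [H, LinearMap.sub_apply, LinearMap.comp_apply, hk'', h1, hk, sub_self]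
  have hπH : ∀ x, π (H x) = g x := fun x => by
    have h1 : π (ι (v (k'' x))) = 0 := (hex _).2 ⟨_, rfl⟩
    simp only [H, LinearMap.sub_apply, LinearMap.comp_apply, map_sub, h1, hG', sub_zero]
  obtain ⟨r, hr⟩ := exists_factor_of_ker_le hfg.2.1 H hH
  refine ⟨r, fun m => ?_⟩
  obtain ⟨x, rfl⟩ := hfg.2.1 m
  rw [hr, hπH]

/-- The identity of a special tilting module `T` factors through a sum of copies of `P` and
`T₁`. -/
lemma id_mem_of_tilting (K : Type) [Field K] [Algebra K R] [Module.Finite K R]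
    {T P T₀ T₁ : Type} [AddCommGroup T] [Module R T] [Module K T] [IsScalarTower K R T]
    [Module.Finite K T] [AddCommGroup P] [Module R P] [Module.Finite R P]
    [AddCommGroup T₀] [Module R T₀] [AddCommGroup T₁] [Module R T₁] [Module.Finite R T₁]
    {P₁ P₀ : Type} [AddCommGroup P₁] [Module R P₁] [AddCommGroup P₀] [Module R P₀]
    [Module.Projective R P₁] [Module.Projective R P₀] {f : P₁ →ₗ[R] P₀} {g : P₀ →ₗ[R] T}
    (hfg : IsShortExact R f g) (q : T₀ →ₗ[R] T₁) (x₀ : T₀) (hTT₀ : Ext1Vanish R T T₀)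
    (hfactor : ∀ s : T₀ →ₗ[R] T, s x₀ = 0 → ∃ r : T₁ →ₗ[R] T, s = r ∘ₗ q) (hq : q x₀ = 0)
    (hP : ∀ x : P, ∃ s : T₀ →ₗ[R] P, s x₀ = x) (hT₁ : ∀ x : T₁, ∃ s : T₀ →ₗ[R] T₁, s x₀ = x)
    (hgen : ∀ t : T, t ∈ Submodule.span R {t | ∃ (h : P →ₗ[R] T) (x : P), t = h x})
    (S : AddSubgroup (Module.End R T))
    (hS : ∀ (θ : T →ₗ[R] P) (h : P →ₗ[R] T), h ∘ₗ θ ∈ S)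
    (hS' : ∀ (β : T →ₗ[R] T₁) (γ : T₁ →ₗ[R] T), γ ∘ₗ β ∈ S) : LinearMap.id ∈ S := by
  obtain ⟨n, h, hh⟩ := exists_hom_generators K (R := R) P T
  obtain ⟨n', h', hh'⟩ := exists_hom_generators K (R := R) T₁ T
  let π : (Fin n → P) × (Fin n' → T₁) →ₗ[R] T :=
    ∑ i, h i ∘ₗ LinearMap.proj i ∘ₗ LinearMap.fst R _ _ +
      ∑ i, h' i ∘ₗ LinearMap.proj i ∘ₗ LinearMap.snd R _ _
  have hπ : ∀ w, π w = ∑ i, h i (w.1 i) + ∑ i, h' i (w.2 i) := fun w => by simp [π]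
  let scal (X : Type) [AddCommGroup X] [Module R X] (c : K) : X →ₗ[R] X :=
    { toFun := fun x => algebraMap K R c • x
      map_add' := smul_add _
      map_smul' := fun r x => by
        rw [RingHom.id_apply, ← mul_smul, ← mul_smul, Algebra.commutes] }
  have liftP : ∀ l : P →ₗ[R] T, ∃ l' : P →ₗ[R] _, ∀ x, π (l' x) = l x := fun l => by
    obtain ⟨c, hc⟩ := hh l
    refine ⟨LinearMap.prod (LinearMap.pi fun i => scal P (c i)) 0, fun x => ?_⟩
    rw [hπ, hc]
    simp [scal]
  have liftT₁ : ∀ l : T₁ →ₗ[R] T, ∃ l' : T₁ →ₗ[R] _, ∀ x, π (l' x) = l x := fun l => by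
    obtain ⟨c, hc⟩ := hh' l
    refine ⟨LinearMap.prod 0 (LinearMap.pi fun i => scal T₁ (c i)), fun x => ?_⟩
    rw [hπ, hc]
    simp [scal]
  have hπs : Surjective π := by
    rw [← LinearMap.range_eq_top, eq_top_iff]
    intro t _
    refine Submodule.span_le.2 ?_ (hgen t)
    rintro _ ⟨l, x, rfl⟩
    obtain ⟨l', hl'⟩ := liftP l
    exact ⟨l' x, hl' x⟩
  have hL : ∀ z : LinearMap.ker π, ∃ u : T₀ →ₗ[R] LinearMap.ker π, u x₀ = z := by
    intro z
    choose s hs using fun i => hP (z.1.1 i)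
    choose s' hs' using fun i => hT₁ (z.1.2 i)
    let σ := LinearMap.prod (LinearMap.pi s) (LinearMap.pi s')
    have hσ : σ x₀ = z := Prod.ext (funext hs) (funext hs')
    obtain ⟨r, hr⟩ := hfactor (π ∘ₗ σ) (by rw [LinearMap.comp_apply, hσ]; exact z.2)
    obtain ⟨r', hr'⟩ := liftT₁ r
    refine ⟨(σ - r' ∘ₗ q).codRestrict (LinearMap.ker π) fun x => ?_, Subtype.ext ?_⟩
    · have h1 : π (σ x) = r (q x) := LinearMap.ext_iff.mp hr x
      simp [h1, hr']
    · show σ x₀ - r' (q x₀) = z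
      rw [hσ, hq, map_zero, sub_zero]
  have : IsNoetherianRing R := isNoetherian_of_tower K inferInstance
  obtain ⟨k, z, hz⟩ := Module.Finite.exists_fin (R := R) (M := LinearMap.ker π)
  choose u hu using fun i => hL (z i)
  let v : (Fin k → T₀) →ₗ[R] LinearMap.ker π := ∑ i, u i ∘ₗ LinearMap.proj i
  have hv : Surjective v := by
    rw [← LinearMap.range_eq_top, eq_top_iff, ← hz, Submodule.span_le]
    rintro _ ⟨i, rfl⟩
    refine ⟨Pi.single i x₀, ?_⟩
    simp only [v, LinearMap.sum_apply, LinearMap.comp_apply, LinearMap.proj_apply]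
    rw [Finset.sum_eq_single i (fun j _ hj => by rw [Pi.single_eq_of_ne hj, map_zero])
      (fun hi => absurd (Finset.mem_univ i) hi), Pi.single_eq_same, hu]
  have hTL : Ext1Vanish R T (LinearMap.ker π) :=
    (hTT₀.of_inAdd_right ⟨k, LinearMap.id, LinearMap.id, rfl⟩).of_surjective hfg v hv
  obtain ⟨σ, hσ⟩ := hTL.exists_lift (f := (LinearMap.ker π).subtype) (g := π)
    ⟨Subtype.val_injective, hπs, fun w => by simp⟩ LinearMap.id
  have hid : (LinearMap.id : Module.End R T) =
      ∑ i, h i ∘ₗ (LinearMap.proj i ∘ₗ LinearMap.fst R _ _ ∘ₗ σ) +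
        ∑ i, h' i ∘ₗ (LinearMap.proj i ∘ₗ LinearMap.snd R _ _ ∘ₗ σ) := by
    ext t
    rw [← hσ, hπ]
    simp
  rw [hid]
  exact S.add_mem (sum_mem fun i _ => hS _ _) (sum_mem fun i _ => hS' _ _)

lemma InAdd.finite {X Y : Type} [AddCommGroup X] [Module R X] [AddCommGroup Y] [Module R Y]
    (h : InAdd R X Y) [Module.Finite R X] : Module.Finite R Y := by
  obtain ⟨n, i, p, hpi⟩ := h
  exact Module.Finite.of_surjective p fun y => ⟨i y, LinearMap.ext_iff.mp hpi y⟩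

lemma IsSpecialTilting.exists_tiltingData (K : Type) [Field K] [Algebra K R] [Module.Finite K R]
    {T P : Type} [AddCommGroup T] [Module R T] [Module K T] [IsScalarTower K R T]
    [Module.Finite K T] [AddCommGroup P] [Module R P] [Module.Projective R P]
    (hT : IsSpecialTilting R P T) :
    ∃ (T₀ T₁ : Type) (_ : AddCommGroup T₀) (_ : Module R T₀) (_ : AddCommGroup T₁)
      (_ : Module R T₁), Nonempty (TiltingData R T P T₀ T₁) := by
  have : Module.Finite R T := Module.Finite.of_restrictScalars_finite K R T
  have : Module.Finite R P := hT.mem_add.finite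
  obtain ⟨T₀, T₁, _, _, _, _, j, q, hT₀, hT₁, hjq⟩ := hT.coresolves_special
  obtain ⟨P₁, P₀, _, _, _, _, f, g, _, _, hfg⟩ := hT.isTilting.pdim_le_one
  have : Module.Finite R T₁ := hT₁.finite
  have hTT : Ext1Vanish R T T := ext1Vanish_of_exists_extension fun Y _ _ f g hfg => by
    obtain ⟨r, hr⟩ := hT.isTilting.rigid Y f g hfg
    exact ⟨r, fun x => LinearMap.ext_iff.mp hr x⟩
  have hT₀T : InAdd R T T₀ := hT.mem_add.trans hT₀
  have ext : ∀ (X : Type) [AddCommGroup X] [Module R X], InAdd R T X → ∀ x : X,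
      ∃ s : T₀ →ₗ[R] X, s (j 1) = x := by
    intro X _ _ hX x
    obtain ⟨s, hs⟩ := ((hTT.of_inAdd_left hT₁).of_inAdd_right hX).exists_extension hjq
      (LinearMap.toSpanSingleton R X x)
    exact ⟨s, by rw [hs, LinearMap.toSpanSingleton_apply, one_smul]⟩
  have hq : q (j 1) = 0 := (hjq.2.2 _).2 ⟨1, rfl⟩
  have hfactor : ∀ s : T₀ →ₗ[R] T, s (j 1) = 0 → ∃ r : T₁ →ₗ[R] T, s = r ∘ₗ q := by
    intro s hs
    obtain ⟨r, hr⟩ := exists_factor_of_ker_le hjq.2.1 s fun x hx => by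
      obtain ⟨γ, rfl⟩ := (hjq.2.2 x).1 hx
      rw [← mul_one γ, ← smul_eq_mul, map_smul, map_smul, hs, smul_zero]
    exact ⟨r, LinearMap.ext fun x => (hr x).symm⟩
  obtain ⟨m, a, c, hac⟩ := inAdd_iff.1 hT₀
  obtain ⟨n, a', c', hac'⟩ := inAdd_iff.1 hT₁
  refine ⟨T₀, T₁, inferInstance, inferInstance, inferInstance, inferInstance,
    ⟨{  m := m
        n := n
        a := a
        c := c
        a' := a'
        c' := c'
        x₀ := j 1
        q := q
        sum_c_a := hac
        sum_c'_a' := hac'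
        q_x₀ := hq
        q_surjective := hjq.2.1
        exists_smul := fun z hz => ?_
        exists_extension := ext T (InAdd.refl T)
        exists_factor := hfactor
        exists_lift := fun h => ?_
        one_mem := fun S hS hS' => id_mem_of_tilting K hfg q (j 1)
          (hTT.of_inAdd_right hT₀T) hfactor hq (ext P hT.mem_add) (ext T₁ hT₁)
          (fun t => ?_) S hS hS' }⟩⟩
  · obtain ⟨γ, rfl⟩ := (hjq.2.2 z).1 hz
    exact ⟨γ, by rw [← map_smul, smul_eq_mul, mul_one]⟩
  · obtain ⟨h', hh'⟩ := Module.projective_lifting_property q h hjq.2.1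
    exact ⟨h', hh'.symm⟩
  · obtain ⟨s, rfl⟩ := ext T (InAdd.refl T) t
    rw [← hac (j 1), map_sum]
    exact sum_mem fun i _ => Submodule.subset_span ⟨s ∘ₗ c i, a i (j 1), rfl⟩

end Tilting

end GenFinitePaper

namespace GenFinitePaper

open Function MulOpposite

section Dual

variable (K : Type) [Field K]

instance ModuleDual.isScalarTower (R : Type) [Ring R] [Algebra K R] (M : Type) [AddCommGroup M]
    [Module R M] [Module K M] [IsScalarTower K R M] :
    IsScalarTower K (Module.End R M)ᵐᵒᵖ (ModuleDual K R M) where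
  smul_assoc k φ f := LinearMap.ext fun x => by
    show ModuleDual.toLin K R M f (k • φ.unop x) = k • ModuleDual.toLin K R M f (φ.unop x)
    rw [map_smul]

instance RegularDual.isScalarTower (R : Type) [Ring R] [Algebra K R] :
    IsScalarTower K R (RegularDual K R) where
  smul_assoc k r f := LinearMap.ext fun x => by
    show RegularDual.toLin K R f (x * k • r) = k • RegularDual.toLin K R f (x * r)
    rw [mul_smul_comm, map_smul]

lemma ModuleDual.ext (R : Type) [Ring R] [Algebra K R] (M : Type) [AddCommGroup M]
    [Module R M] [Module K M] [IsScalarTower K R M] {f g : ModuleDual K R M}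
    (h : ∀ x, ModuleDual.toLin K R M f x = ModuleDual.toLin K R M g x) : f = g :=
  LinearMap.ext h

lemma exists_transpose {V : Type} [AddCommGroup V] [Module K V] [FiniteDimensional K V]
    (χ : Module.Dual K V →ₗ[K] Module.Dual K V) :
    ∃ ψ : V →ₗ[K] V, ∀ ξ x, χ ξ x = ξ (ψ x) := by
  refine ⟨(Module.evalEquiv K V).symm.toLinearMap ∘ₗ χ.dualMap ∘ₗ Module.Dual.eval K V,
    fun ξ x => ?_⟩
  simp

end Dual

section Cogenerator

variable (K A : Type) [Field K] [Ring A] [Algebra K A]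
  (E : Type) [AddCommGroup E] [Module A E] [Module K E] [IsScalarTower K A E]

variable {E} in
/-- The dual of a cogenerator `E` is projective over the opposite endomorphism ring of `E`. -/
lemma IsCogenerator.projective_dual [FiniteDimensional K A] (hE : IsCogenerator A E) :
    Module.Projective (Module.End A E)ᵐᵒᵖ (ModuleDual K A E) := by
  have : Module.Finite K (RegularDual K A) := inferInstanceAs (Module.Finite K (A →ₗ[K] K))
  obtain ⟨n, α, hα⟩ := hE (RegularDual K A) (Module.Finite.of_restrictScalars_finite K A _)
  let ev : RegularDual K A →ₗ[K] K :=
    { toFun := fun f => RegularDual.toLin K A f 1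
      map_add' := fun _ _ => rfl
      map_smul' := fun _ _ => rfl }
  obtain ⟨μ, hμ⟩ := exists_functional_comp_eq (α.restrictScalars K) ev fun f hf => by
    have : f = 0 := hα (hf.trans (map_zero α).symm)
    rw [this, map_zero]
  have hμ' : ∀ f, μ (α f) = RegularDual.toLin K A f 1 := hμ
  let ρ : ModuleDual K A E → E →ₗ[A] RegularDual K A := fun ξ =>
    { toFun := fun x => ModuleDual.toLin K A E ξ ∘ₗ
        (LinearMap.toSpanSingleton A E x).restrictScalars K
      map_add' := fun x y => LinearMap.ext fun a => by
        show ModuleDual.toLin K A E ξ (a • (x + y)) =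
          ModuleDual.toLin K A E ξ (a • x) + ModuleDual.toLin K A E ξ (a • y)
        rw [smul_add, map_add]
      map_smul' := fun b x => LinearMap.ext fun a => by
        show ModuleDual.toLin K A E ξ (a • b • x) = ModuleDual.toLin K A E ξ ((a * b) • x)
        rw [mul_smul] }
  let c : ModuleDual K A E →ₗ[(Module.End A E)ᵐᵒᵖ] (Fin n → (Module.End A E)ᵐᵒᵖ) :=
    { toFun := fun ξ i => op (LinearMap.proj i ∘ₗ α ∘ₗ ρ ξ)
      map_add' := fun ξ ξ' => funext fun i => by
        rw [Pi.add_apply, ← op_add, ← LinearMap.comp_add, ← LinearMap.comp_add]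
        rfl
      map_smul' := fun φ ξ => funext fun i => by
        obtain ⟨φ, rfl⟩ := op_surjective φ
        refine congrArg op (LinearMap.ext fun x => ?_)
        show α (ρ (op φ • ξ) x) i = α (ρ ξ (φ x)) i
        refine congrFun (congrArg α ?_) i
        refine LinearMap.ext fun (a : A) => ?_
        show ModuleDual.toLin K A E ξ (φ (a • x)) = ModuleDual.toLin K A E ξ (a • φ x)
        rw [map_smul] }
  let ζ : Fin n → ModuleDual K A E := fun i => μ ∘ₗ LinearMap.single K (fun _ => E) i
  refine Module.Projective.of_split c (∑ i, LinearMap.toSpanSingleton (Module.End A E)ᵐᵒᵖ _ (ζ i) ∘ₗ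
    LinearMap.proj i)
    (LinearMap.ext fun ξ => ModuleDual.ext K A E fun x => ?_)
  have h1 : (∑ i, LinearMap.toSpanSingleton (Module.End A E)ᵐᵒᵖ _ (ζ i) ∘ₗ LinearMap.proj i) (c ξ) =
      ∑ i, c ξ i • ζ i := by simp
  rw [LinearMap.comp_apply, h1]
  have h2 : ∀ s : Finset (Fin n), ModuleDual.toLin K A E (∑ i ∈ s, c ξ i • ζ i) x =
      ∑ i ∈ s, μ (Pi.single i (α (ρ ξ x) i)) := fun s => by
    induction s using Finset.cons_induction with
    | empty => rfl
    | cons i s hi ih =>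
      rw [Finset.sum_cons, Finset.sum_cons, ← ih]
      rfl
  rw [h2, ← map_sum, Finset.univ_sum_single, hμ']
  show ModuleDual.toLin K A E ξ ((1 : A) • x) = _
  rw [one_smul]
  rfl

variable [FiniteDimensional K E]

instance finite_end_op : Module.Finite K (Module.End A E)ᵐᵒᵖ := by
  have : Module.Finite K (Module.End A E) := Module.Finite.of_injective
    (LinearMap.restrictScalarsₗ K A E E K) (LinearMap.restrictScalars_injective K)
  exact Module.Finite.equiv (MulOpposite.opLinearEquiv K)

variable {E} in
/-- The double centralizer property of a cogenerator. -/
lemma IsCogenerator.exists_eq_smul (hE : IsCogenerator A E) (ψ : E →ₗ[K] E)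
    (hψ : ∀ (φ : Module.End A E) x, ψ (φ x) = φ (ψ x)) : ∃ a : A, ∀ x, ψ x = a • x := by
  have : Module.Finite A E := Module.Finite.of_restrictScalars_finite K A E
  obtain ⟨m, w, hw⟩ := Module.Finite.exists_fin (R := K) (M := E)
  let S : Submodule A (Fin m → E) := Submodule.span A {w}
  obtain ⟨l, β, hβ⟩ := hE ((Fin m → E) ⧸ S) inferInstance
  have hmem : (fun i => ψ (w i)) ∈ S := by
    rw [← Submodule.Quotient.mk_eq_zero]
    refine hβ ?_
    rw [map_zero]
    funext j
    let φ : Fin m → Module.End A E := fun i =>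
      LinearMap.proj j ∘ₗ β ∘ₗ S.mkQ ∘ₗ LinearMap.single A (fun _ => E) i
    have hφ : ∀ v : Fin m → E, β (S.mkQ v) j = ∑ i, φ i (v i) := fun v => by
      conv_lhs => rw [← Finset.univ_sum_single v]
      simp [φ]
    have h1 : β (S.mkQ w) j = 0 := by
      have : S.mkQ w = 0 :=
        (Submodule.Quotient.mk_eq_zero S).2 (Submodule.mem_span_singleton_self w)
      rw [this, map_zero]
      rfl
    refine (hφ _).trans ?_
    simp only [← hψ, ← map_sum]
    rw [← hφ, h1, map_zero]
    rfl
  obtain ⟨a, ha⟩ := Submodule.mem_span_singleton.1 hmem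
  refine ⟨a, fun x => ?_⟩
  have hx : ψ = smulKLin K A E a := by
    refine LinearMap.ext_on_range hw fun i => ?_
    exact (congrFun ha i).symm
  rw [hx]
  rfl

variable {E} in
lemma IsCogenerator.exists_eq_dualAct (hE : IsCogenerator A E)
    (χ : ModuleDual K A E →ₗ[(Module.End A E)ᵐᵒᵖ] ModuleDual K A E) :
    ∃ a, χ = dualAct K A E a := by
  obtain ⟨ψ, hψ⟩ := exists_transpose K (V := E) (χ.restrictScalars K)
  have hψ' : ∀ ξ x, ModuleDual.toLin K A E (χ ξ) x = ModuleDual.toLin K A E ξ (ψ x) := hψ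
  obtain ⟨a, ha⟩ := hE.exists_eq_smul K A ψ fun φ x => by
    rw [← sub_eq_zero, ← Module.forall_dual_apply_eq_zero_iff K]
    intro (ξ : ModuleDual K A E)
    show ModuleDual.toLin K A E ξ (ψ (φ x) - φ (ψ x)) = 0
    rw [map_sub, sub_eq_zero]
    have h1 := hψ' (op φ • ξ) x
    rw [map_smul] at h1
    exact (hψ' ξ (φ x)).symm.trans h1
  refine ⟨a, LinearMap.ext fun ξ => ModuleDual.ext K A E fun x => ?_⟩
  rw [hψ', ha]
  rfl

variable {E} in
lemma IsCogenerator.exists_corner_eq (hE : IsCogenerator A E)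
    {T : Type} [AddCommGroup T] [Module (Module.End A E)ᵐᵒᵖ T]
    (i₀ : ModuleDual K A E →ₗ[(Module.End A E)ᵐᵒᵖ] T)
    (p₀ : T →ₗ[(Module.End A E)ᵐᵒᵖ] ModuleDual K A E) (hsplit : p₀.comp i₀ = LinearMap.id)
    (b : (Module.End (Module.End A E)ᵐᵒᵖ T)ᵐᵒᵖ) :
    ∃ a, (canonicalCornerMap K A E T i₀ p₀ hsplit).toHom a =
      op (i₀.comp p₀) * b * op (i₀.comp p₀) := by
  obtain ⟨a, ha⟩ := hE.exists_eq_dualAct K A (p₀ ∘ₗ b.unop ∘ₗ i₀)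
  refine ⟨a, ?_⟩
  show op ((i₀.comp (dualAct K A E a)).comp p₀) = _
  rw [← ha]
  rfl

end Cogenerator

end GenFinitePaper

namespace GenFinitePaper

open Function MulOpposite

namespace TiltingData

section

variable {Γ T P T₀ T₁ : Type} [Ring Γ] [AddCommGroup T] [Module Γ T] [AddCommGroup P] [Module Γ P]
  [AddCommGroup T₀] [Module Γ T₀] [AddCommGroup T₁] [Module Γ T₁]
  {i₀ : P →ₗ[Γ] T} {p₀ : T →ₗ[Γ] P}

/-- `T` is generated by `P`. -/
lemma eq_zero_of_forall_comp (D : TiltingData Γ T P T₀ T₁)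
    {Y : Type} [AddCommGroup Y] (f : T →+ Y)
    (hf : ∀ (h : P →ₗ[Γ] T) x, f (h x) = 0) (t : T) : f t = 0 := by
  obtain ⟨s, rfl⟩ := D.exists_extension t
  rw [← D.sum_c_a D.x₀, map_sum, map_sum]
  exact Finset.sum_eq_zero fun i _ => hf (s ∘ₗ D.c i) _

lemma isStableMod_self (D : TiltingData Γ T P T₀ T₁)
    (hsplit : p₀ ∘ₗ i₀ = LinearMap.id) :
    IsStableMod (Module.End Γ T)ᵐᵒᵖ (op (i₀ ∘ₗ p₀)) (Module.End Γ T)ᵐᵒᵖ := by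
  intro b hb
  have hsp : ∀ x, p₀ (i₀ x) = x := fun x => LinearMap.ext_iff.mp hsplit x
  refine unop_injective (LinearMap.ext fun t => ?_)
  refine D.eq_zero_of_forall_comp b.unop.toAddMonoidHom (fun h x => ?_) t
  have h1 := LinearMap.congr_fun (congrArg unop (hb (op (h ∘ₗ p₀)))) (i₀ x)
  have h2 : b.unop (h (p₀ (i₀ (p₀ (i₀ x))))) = 0 := h1
  rwa [hsp, hsp] at h2

variable (K : Type) [Field K] [Algebra K Γ] [Module K T] [IsScalarTower K Γ T]

lemma isStableMod_dual (D : TiltingData Γ T P T₀ T₁)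
    (hsplit : p₀ ∘ₗ i₀ = LinearMap.id) :
    IsStableMod (Module.End Γ T)ᵐᵒᵖ (op (i₀ ∘ₗ p₀)) (ModuleDual K Γ T) := by
  intro f hf
  have hsp : ∀ x, p₀ (i₀ x) = x := fun x => LinearMap.ext_iff.mp hsplit x
  refine ModuleDual.ext K Γ T fun t => ?_
  refine D.eq_zero_of_forall_comp (ModuleDual.toLin K Γ T f).toAddMonoidHom (fun h x => ?_) t
  have h1 := LinearMap.congr_fun (hf (op (h ∘ₗ p₀))) (i₀ x)
  have h2 : ModuleDual.toLin K Γ T f (h (p₀ (i₀ (p₀ (i₀ x))))) = 0 := h1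
  rwa [hsp, hsp] at h2

lemma ext1Vanish_dual (D : TiltingData Γ T P T₀ T₁)
    (hsplit : p₀ ∘ₗ i₀ = LinearMap.id) {Y : Type} [AddCommGroup Y]
    [Module (Module.End Γ T)ᵐᵒᵖ Y] (hY : IsStableMod _ (op (i₀ ∘ₗ p₀)) Y) :
    Ext1Vanish (Module.End Γ T)ᵐᵒᵖ Y (ModuleDual K Γ T) := by
  refine ext1Vanish_of_exists_extension fun X _ _ f g hfg => ?_
  let : Module K X := Module.compHom X (algebraMap K (Module.End Γ T)ᵐᵒᵖ)
  have : IsScalarTower K (Module.End Γ T)ᵐᵒᵖ X := IsScalarTower.of_algebraMap_smul fun _ _ => rfl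
  let fe := LinearEquiv.ofInjective f hfg.1
  have hle : LinearMap.range f ≤ LinearMap.ker g := by
    rintro _ ⟨x, rfl⟩
    exact (hfg.2.2 _).2 ⟨x, rfl⟩
  have hst : IsStableMod _ (op (i₀ ∘ₗ p₀)) (X ⧸ LinearMap.range f) := by
    refine hY.of_injective ((LinearMap.range f).liftQ g hle) ?_
    rw [← LinearMap.ker_eq_bot, Submodule.ker_liftQ_eq_bot]
    exact fun x hx => (hfg.2.2 x).1 hx
  obtain ⟨g', hg'⟩ := D.exists_extension_of_stable K hsplit (LinearMap.range f) hst
    fe.symm.toLinearMap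
  refine ⟨g', fun x => ?_⟩
  have h1 := hg' (fe x)
  rw [LinearEquiv.coe_coe, LinearEquiv.symm_apply_apply] at h1
  exact h1

end

section

variable {K A : Type} [Field K] [Ring A] [Algebra K A]
  {E : Type} [AddCommGroup E] [Module A E] [Module K E] [IsScalarTower K A E]
  [FiniteDimensional K E] {T T₀ T₁ : Type} [AddCommGroup T] [Module (Module.End A E)ᵐᵒᵖ T]
  [AddCommGroup T₀] [Module (Module.End A E)ᵐᵒᵖ T₀] [AddCommGroup T₁]
  [Module (Module.End A E)ᵐᵒᵖ T₁]
  {i₀ : ModuleDual K A E →ₗ[(Module.End A E)ᵐᵒᵖ] T}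
  {p₀ : T →ₗ[(Module.End A E)ᵐᵒᵖ] ModuleDual K A E}

lemma exists_smul_of_forall_eq_zero
    (D : TiltingData (Module.End A E)ᵐᵒᵖ T (ModuleDual K A E) T₀ T₁)
    (hsplit : p₀ ∘ₗ i₀ = LinearMap.id) (z : T₀)
    (hz : ∀ θ : T₀ →ₗ[(Module.End A E)ᵐᵒᵖ] ModuleDual K A E, θ D.x₀ = 0 → θ z = 0) :
    ∃ γ : (Module.End A E)ᵐᵒᵖ, γ • D.x₀ = z := by
  have hsp : ∀ x, p₀ (i₀ x) = x := fun x => LinearMap.ext_iff.mp hsplit x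
  have hext : ∀ ξ : ModuleDual K A E, ∃ s : T₀ →ₗ[(Module.End A E)ᵐᵒᵖ] ModuleDual K A E,
      s D.x₀ = ξ := fun ξ => by
    obtain ⟨s, hs⟩ := D.exists_extension (i₀ ξ)
    exact ⟨p₀ ∘ₗ s, by rw [LinearMap.comp_apply, hs, hsp]⟩
  have hwd : ∀ s s' : T₀ →ₗ[(Module.End A E)ᵐᵒᵖ] ModuleDual K A E, s D.x₀ = s' D.x₀ →
      s z = s' z := fun s s' h => by
    have h1 := hz (s - s') (by rw [LinearMap.sub_apply, h, sub_self])
    rwa [LinearMap.sub_apply, sub_eq_zero] at h1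
  choose s hs using hext
  let F : ModuleDual K A E →ₗ[K] ModuleDual K A E :=
    { toFun := fun ξ => s ξ z
      map_add' := fun ξ ξ' => hwd _ (s ξ + s ξ') (by rw [LinearMap.add_apply, hs, hs, hs])
      map_smul' := fun k ξ => hwd _ (k • s ξ) (by rw [LinearMap.smul_apply, hs, hs]) }
  have hF : ∀ s' : T₀ →ₗ[(Module.End A E)ᵐᵒᵖ] ModuleDual K A E, F (s' D.x₀) = s' z :=
    fun s' => hwd _ _ (hs _)
  obtain ⟨ψ, hψ⟩ := exists_transpose K (V := E) F
  have hψ' : ∀ ξ x, ModuleDual.toLin K A E (F ξ) x = ModuleDual.toLin K A E ξ (ψ x) := hψ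
  let φ : Module.End A E :=
    { toFun := ψ
      map_add' := map_add ψ
      map_smul' := fun a x => by
        rw [RingHom.id_apply, ← sub_eq_zero, ← Module.forall_dual_apply_eq_zero_iff K]
        intro (ξ : ModuleDual K A E)
        show ModuleDual.toLin K A E ξ (ψ (a • x) - a • ψ x) = 0
        rw [map_sub, sub_eq_zero, ← hψ']
        have h1 : F (dualAct K A E a ξ) = dualAct K A E a (F ξ) := by
          have h2 := hF (dualAct K A E a ∘ₗ s ξ)
          rw [LinearMap.comp_apply, LinearMap.comp_apply, hs] at h2
          exact h2
        have h3 := hψ' (dualAct K A E a ξ) x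
        rw [h1] at h3
        exact h3 }
  have hφ : ∀ ξ, F ξ = op φ • ξ := fun ξ => ModuleDual.ext K A E fun x => hψ' ξ x
  refine ⟨op φ, ?_⟩
  rw [← D.sum_c_a D.x₀, ← D.sum_c_a z, Finset.smul_sum]
  refine Finset.sum_congr rfl fun i _ => ?_
  rw [← map_smul, ← hφ, hF]

/-- `T` is cogenerated by `D E`. -/
lemma eq_zero_of_forall_dual
    (D : TiltingData (Module.End A E)ᵐᵒᵖ T (ModuleDual K A E) T₀ T₁)
    (hsplit : p₀ ∘ₗ i₀ = LinearMap.id) (t : T)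
    (ht : ∀ θ : T →ₗ[(Module.End A E)ᵐᵒᵖ] ModuleDual K A E, θ t = 0) : t = 0 := by
  have hsp : ∀ x, p₀ (i₀ x) = x := fun x => LinearMap.ext_iff.mp hsplit x
  let S : AddSubgroup (Module.End (Module.End A E)ᵐᵒᵖ T) :=
    { carrier := {f | f t = 0}
      add_mem' := fun {f f'} hf hf' => by
        show f t + f' t = 0
        rw [show f t = 0 from hf, show f' t = 0 from hf', add_zero]
      zero_mem' := rfl
      neg_mem' := fun {f} hf => by
        show -f t = 0
        rw [show f t = 0 from hf, neg_zero] }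
  refine D.one_mem S (fun θ h => ?_) (fun β γ => ?_)
  · show h (θ t) = 0
    rw [ht, map_zero]
  · show γ (β t) = 0
    obtain ⟨z, hz⟩ := D.q_surjective (β t)
    obtain ⟨g, rfl⟩ := D.exists_smul_of_forall_eq_zero hsplit z fun θ hθ => by
      obtain ⟨r, hr⟩ := D.exists_factor (i₀ ∘ₗ θ) (by rw [LinearMap.comp_apply, hθ, map_zero])
      have h1 : i₀ (θ z) = r (D.q z) := LinearMap.congr_fun hr z
      rw [← hsp (θ z), h1, hz]
      exact ht (p₀ ∘ₗ r ∘ₗ β)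
    rw [← hz, map_smul, D.q_x₀, smul_zero, map_zero]

variable [Module K T] [IsScalarTower K (Module.End A E)ᵐᵒᵖ T]

lemma isCostableMod_dual
    (D : TiltingData (Module.End A E)ᵐᵒᵖ T (ModuleDual K A E) T₀ T₁)
    [FiniteDimensional K T] (hsplit : p₀ ∘ₗ i₀ = LinearMap.id) :
    IsCostableMod (Module.End (Module.End A E)ᵐᵒᵖ T)ᵐᵒᵖ (op (i₀ ∘ₗ p₀))
      (ModuleDual K (Module.End A E)ᵐᵒᵖ T) := by
  have hsp : ∀ x, p₀ (i₀ x) = x := fun x => LinearMap.ext_iff.mp hsplit x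
  intro f _
  set S := Submodule.span (Module.End (Module.End A E)ᵐᵒᵖ T)ᵐᵒᵖ
    {z : ModuleDual K (Module.End A E)ᵐᵒᵖ T | ∃ w, z = op (i₀ ∘ₗ p₀) • w} with hS
  by_contra hf
  obtain ⟨l, hl, hle⟩ := Submodule.exists_le_ker_of_notMem (p := S.restrictScalars K) hf
  obtain ⟨t, ht⟩ := (Module.evalEquiv K T).surjective l
  have hlt : ∀ g : ModuleDual K (Module.End A E)ᵐᵒᵖ T,
      l g = ModuleDual.toLin K (Module.End A E)ᵐᵒᵖ T g t := fun g => by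
    rw [← ht]
    rfl
  refine hl ?_
  rw [hlt, D.eq_zero_of_forall_dual hsplit t fun θ => ?_, map_zero]
  rw [← Module.forall_dual_apply_eq_zero_iff K]
  intro κ
  have h1 : (κ ∘ₗ θ.restrictScalars K : T →ₗ[K] K) ∈ S := by
    have h2 : (op (i₀ ∘ₗ θ) : (Module.End (Module.End A E)ᵐᵒᵖ T)ᵐᵒᵖ) • op (i₀ ∘ₗ p₀) •
        (show ModuleDual K (Module.End A E)ᵐᵒᵖ T from κ ∘ₗ p₀.restrictScalars K) =
          κ ∘ₗ θ.restrictScalars K := by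
      refine LinearMap.ext fun x => ?_
      show κ (p₀ (i₀ (p₀ (i₀ (θ x))))) = κ (θ x)
      rw [hsp, hsp]
    rw [← h2]
    exact S.smul_mem _ (Submodule.subset_span ⟨_, rfl⟩)
  exact (hlt _).symm.trans (hle h1)

lemma isIntermediateExtension_dual
    (D : TiltingData (Module.End A E)ᵐᵒᵖ T (ModuleDual K A E) T₀ T₁)
    [FiniteDimensional K T] (hsplit : p₀.comp i₀ = LinearMap.id) :
    IsIntermediateExtension (canonicalCornerMap K A E T i₀ p₀ hsplit) E
      (ModuleDual K (Module.End A E)ᵐᵒᵖ T) := by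
  have hsp : ∀ x, p₀ (i₀ x) = x := fun x => LinearMap.ext_iff.mp hsplit x
  refine ⟨D.isCostableMod_dual hsplit, D.isStableMod_dual K hsplit, ⟨LinearEquiv.symm ?_⟩⟩
  let f : E →ₗ[A] ePart (canonicalCornerMap K A E T i₀ p₀ hsplit)
      (ModuleDual K (Module.End A E)ᵐᵒᵖ T) :=
    { toFun := fun x => ⟨Module.Dual.eval K E x ∘ₗ
          (p₀.restrictScalars K : T →ₗ[K] ModuleDual K A E), LinearMap.ext fun t => by
        show ModuleDual.toLin K A E (p₀ (i₀ (p₀ t))) x = ModuleDual.toLin K A E (p₀ t) x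
        rw [hsp]⟩
      map_add' := fun x y => Subtype.ext (LinearMap.ext fun t =>
        map_add (ModuleDual.toLin K A E (p₀ t)) x y)
      map_smul' := fun a x => Subtype.ext (LinearMap.ext fun t => by
        show ModuleDual.toLin K A E (p₀ t) (a • x) =
          ModuleDual.toLin K A E (p₀ (i₀ (dualAct K A E a (p₀ t)))) x
        rw [hsp]
        rfl) }
  have hf : ∀ x t, ModuleDual.toLin K (Module.End A E)ᵐᵒᵖ T (f x).val t =
    ModuleDual.toLin K A E (p₀ t) x := fun _ _ => rfl
  refine LinearEquiv.ofBijective f ⟨?_, fun g => ?_⟩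
  · rw [injective_iff_map_eq_zero]
    intro x hx
    rw [← Module.forall_dual_apply_eq_zero_iff K]
    intro (ξ : ModuleDual K A E)
    have h1 := hf x (i₀ ξ)
    rw [hsp, hx] at h1
    exact h1.symm
  · obtain ⟨x, hx⟩ := (Module.evalEquiv K E).surjective
      (ModuleDual.toLin K (Module.End A E)ᵐᵒᵖ T g.val ∘ₗ
        (i₀.restrictScalars K : ModuleDual K A E →ₗ[K] T))
    refine ⟨x, Subtype.ext (LinearMap.ext fun t => ?_)⟩
    exact (LinearMap.congr_fun hx (p₀ t)).trans (LinearMap.congr_fun g.prop t)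

end

end TiltingData

end GenFinitePaper

namespace GenFinitePaper

open Function

section

variable {R : Type} [Ring R]

lemma IsShortExact.exists_factor {X Y Z W : Type} [AddCommGroup X] [Module R X] [AddCommGroup Y]
    [Module R Y] [AddCommGroup Z] [Module R Z] [AddCommGroup W] [Module R W] {f : X →ₗ[R] Y}
    {g : Y →ₗ[R] Z} (hfg : IsShortExact R f g) (k : W →ₗ[R] Y) (hk : ∀ w, g (k w) = 0) :
    ∃ h : W →ₗ[R] X, ∀ w, f (h w) = k w := by
  let fe := LinearEquiv.ofInjective f hfg.1
  refine ⟨fe.symm.toLinearMap ∘ₗ k.codRestrict (LinearMap.range f) fun w =>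
    (hfg.2.2 _).1 (hk w), fun w => ?_⟩
  exact congrArg Subtype.val (fe.apply_symm_apply _)

lemma isShortExact_mkQ {X : Type} [AddCommGroup X] [Module R X] (U : Submodule R X) :
    IsShortExact R U.subtype U.mkQ :=
  ⟨U.subtype_injective, U.mkQ_surjective, LinearMap.exact_subtype_mkQ U⟩

lemma isShortExact_ker {X Y : Type} [AddCommGroup X] [Module R X] [AddCommGroup Y] [Module R Y]
    (g : X →ₗ[R] Y) (hg : Surjective g) : IsShortExact R (LinearMap.ker g).subtype g :=
  ⟨(LinearMap.ker g).subtype_injective, hg, LinearMap.exact_subtype_ker_map g⟩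

lemma ext1Vanish_of_projective_presentation {Ω F Y Z : Type} [AddCommGroup Ω] [Module R Ω]
    [AddCommGroup F] [Module R F] [AddCommGroup Y] [Module R Y] [AddCommGroup Z] [Module R Z]
    [Module.Projective R F] {f : Ω →ₗ[R] F} {g : F →ₗ[R] Y} (hfg : IsShortExact R f g)
    (hext : ∀ h : Ω →ₗ[R] Z, ∃ h' : F →ₗ[R] Z, ∀ x, h' (f x) = h x) : Ext1Vanish R Y Z := by
  refine ext1Vanish_of_exists_lift fun X _ _ j p hjp => ?_
  obtain ⟨l, hl⟩ := Module.projective_lifting_property p g hjp.2.1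
  have hl' : ∀ x, p (l x) = g x := fun x => LinearMap.congr_fun hl x
  have hgf : ∀ w, g (f w) = 0 := fun w => (hfg.2.2 _).2 ⟨w, rfl⟩
  obtain ⟨h, hh⟩ := hjp.exists_factor (l ∘ₗ f) fun w => by
    rw [LinearMap.comp_apply, hl', hgf]
  obtain ⟨h', hh'⟩ := hext h
  obtain ⟨r, hr⟩ := exists_factor_of_ker_le hfg.2.1 (l - j ∘ₗ h') fun x hx => by
    obtain ⟨w, rfl⟩ := (hfg.2.2 x).1 hx
    rw [LinearMap.sub_apply, LinearMap.comp_apply, hh', hh, LinearMap.comp_apply, sub_self]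
  refine ⟨r, fun y => ?_⟩
  obtain ⟨x, rfl⟩ := hfg.2.1 y
  rw [hr, LinearMap.sub_apply, LinearMap.comp_apply, map_sub, hl', (hjp.2.2 _).2 ⟨_, rfl⟩,
    sub_zero]

lemma Ext1Vanish.of_coresolution {Ω F Y U C₀ C₁ : Type} [AddCommGroup Ω] [Module R Ω]
    [AddCommGroup F] [Module R F] [AddCommGroup Y] [Module R Y] [AddCommGroup U] [Module R U]
    [AddCommGroup C₀] [Module R C₀] [AddCommGroup C₁] [Module R C₁]
    [Module.Projective R F] {f : Ω →ₗ[R] F} {g : F →ₗ[R] Y} (hfg : IsShortExact R f g)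
    {α : U →ₗ[R] C₀} {β : C₀ →ₗ[R] C₁} (hαβ : IsShortExact R α β)
    (hΩ : Ext1Vanish R Ω C₀) (hY : Ext1Vanish R Y C₁) : Ext1Vanish R Ω U := by
  refine ext1Vanish_of_exists_extension fun X _ _ j p hjp => ?_
  obtain ⟨α', hα'⟩ := hΩ.exists_extension hjp α
  obtain ⟨r, hr⟩ := exists_factor_of_ker_le hjp.2.1 (β ∘ₗ α') fun x hx => by
    obtain ⟨u, rfl⟩ := (hjp.2.2 x).1 hx
    rw [LinearMap.comp_apply, hα']
    exact (hαβ.2.2 _).2 ⟨u, rfl⟩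
  obtain ⟨r', hr'⟩ := hY.exists_extension hfg r
  obtain ⟨s, hs⟩ := Module.projective_lifting_property β r' hαβ.2.1
  have hs' : ∀ x, β (s x) = r' x := fun x => LinearMap.congr_fun hs x
  obtain ⟨ρ, hρ⟩ := hαβ.exists_factor (α' - s ∘ₗ f ∘ₗ p) fun x => by
    rw [LinearMap.sub_apply, map_sub, LinearMap.comp_apply, LinearMap.comp_apply, hs', hr', hr,
      LinearMap.comp_apply, sub_self]
  refine ⟨ρ, fun u => hαβ.1 ?_⟩
  rw [hρ, LinearMap.sub_apply, hα', LinearMap.comp_apply, LinearMap.comp_apply,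
    (hjp.2.2 _).2 ⟨u, rfl⟩, map_zero, map_zero, sub_zero]

end

section

variable {B : Type} [Ring B] {e : B}

lemma ext1Vanish_quotient_of_stable (hB : IsStableMod B e B) {X C₀ C₁ : Type} [AddCommGroup X]
    [Module B X] [AddCommGroup C₀] [Module B C₀] [AddCommGroup C₁] [Module B C₁]
    {U : Submodule B X} {α : U →ₗ[B] C₀} {β : C₀ →ₗ[B] C₁} (hαβ : IsShortExact B α β)
    (hX : ∀ (Y : Type) [AddCommGroup Y] [Module B Y], IsStableMod B e Y → Ext1Vanish B Y X)
    (hC₀ : ∀ (Y : Type) [AddCommGroup Y] [Module B Y], IsStableMod B e Y → Ext1Vanish B Y C₀)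
    (hC₁ : ∀ (Y : Type) [AddCommGroup Y] [Module B Y], IsStableMod B e Y → Ext1Vanish B Y C₁)
    {Y : Type} [AddCommGroup Y] [Module B Y] (hY : IsStableMod B e Y) :
    Ext1Vanish B Y (X ⧸ U) := by
  let g : (Y →₀ B) →ₗ[B] Y := Finsupp.linearCombination B id
  have hg : Surjective g := Finsupp.linearCombination_id_surjective B Y
  have hfg := isShortExact_ker g hg
  have hΩ : IsStableMod B e (LinearMap.ker g) :=
    (hB.of_projective (Y →₀ B)).of_injective _ (Submodule.subtype_injective _)
  refine ext1Vanish_of_projective_presentation hfg fun h => ?_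
  obtain ⟨h₁, hh₁⟩ := (Ext1Vanish.of_coresolution hfg hαβ (hC₀ _ hΩ) (hC₁ _ hY)).exists_lift
    (isShortExact_mkQ U) h
  obtain ⟨h₂, hh₂⟩ := (hX _ hY).exists_extension hfg h₁
  refine ⟨U.mkQ ∘ₗ h₂, fun x => ?_⟩
  rw [LinearMap.comp_apply, hh₂, hh₁]

lemma extVanishAll_of_stable (hB : IsStableMod B e B) {Z : Type} [AddCommGroup Z] [Module B Z]
    (hZ : ∀ (Y : Type) [AddCommGroup Y] [Module B Y], IsStableMod B e Y → Ext1Vanish B Y Z)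
    {Y : Type} [AddCommGroup Y] [Module B Y] (hY : IsStableMod B e Y) : ExtVanishAll B Y Z := by
  intro i
  induction i generalizing Y with
  | zero => exact hZ Y hY
  | succ i ih =>
    intro Ω P _ _ _ _ f g _ hfg
    exact ih ((hB.of_projective P).of_injective f hfg.1)

end

section

variable {A B : Type} [Ring A] [Ring B] {e : B} {φ : CornerMap A B e}

/-- If `E ≃ N × Q` with `Q` injective, a map from a submodule `U` of `X` to `c(E)` decomposes as a
map factoring through the submodule `V = c(N)` of `c(E)` plus a map extending to `X`. -/
lemma exists_submodule_decomposition (hφ : ∀ b, ∃ a, φ.toHom a = e * b * e)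
    {E N Q : Type} [AddCommGroup E] [Module A E] [AddCommGroup N] [Module A N]
    [AddCommGroup Q] [Module A Q] (ε : E ≃ₗ[A] N × Q) (hQ : Module.Injective A Q)
    {C : Type} [AddCommGroup C] [Module B C] (hC : IsIntermediateExtension φ E C) :
    ∃ V : Submodule B C, IsCostableMod B e V ∧
      (∃ π : N →ₗ[A] ePart φ V, Surjective π) ∧
      ∀ (X : Type) [AddCommGroup X] [Module B X], IsCostableMod B e X →
        ∀ (U : Submodule B X) (g : U →ₗ[B] C), ∃ (g₁ : U →ₗ[B] V) (g₂ : X →ₗ[B] C),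
          ∀ u : U, g u = g₁ u + g₂ u := by
  obtain ⟨hC₁, hC₂, ⟨ψ⟩⟩ := hC
  obtain ⟨H, hH⟩ := exists_hom_of_ePart_hom φ hφ hC₁ hC₂ (ψ.symm.toLinearMap ∘ₗ
    ε.symm.toLinearMap ∘ₗ LinearMap.inl A N Q ∘ₗ LinearMap.fst A N Q ∘ₗ ε.toLinearMap ∘ₗ
    ψ.toLinearMap)
  have hH' : ∀ y : ePart φ C, H y.val = (ψ.symm (ε.symm ((ε (ψ y)).1, 0))).val := hH
  refine ⟨LinearMap.range H, hC₁.of_surjective H.rangeRestrict H.surjective_rangeRestrict,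
    ⟨ePart.map φ H.rangeRestrict ∘ₗ ψ.symm.toLinearMap ∘ₗ ε.symm.toLinearMap ∘ₗ
      LinearMap.inl A N Q, fun y => ?_⟩, fun X _ _ hX U g => ?_⟩
  · obtain ⟨x, rfl⟩ := ePart.map_surjective φ _ H.surjective_rangeRestrict y
    refine ⟨(ε (ψ x)).1, Subtype.ext (Subtype.ext ?_)⟩
    show H (ψ.symm (ε.symm ((ε (ψ x)).1, 0))).val = H x.val
    rw [hH', hH']
    simp
  · let k : ePart φ U →ₗ[A] Q :=
      LinearMap.snd A N Q ∘ₗ ε.toLinearMap ∘ₗ ψ.toLinearMap ∘ₗ ePart.map φ g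
    obtain ⟨k', hk'⟩ := hQ.out (ePart.map φ U.subtype) (fun y y' h => Subtype.ext (Subtype.ext
      (congrArg (ePart.val φ X) h))) k
    obtain ⟨G, hG⟩ := exists_hom_of_ePart_hom φ hφ hX hC₂ (ψ.symm.toLinearMap ∘ₗ
      ε.symm.toLinearMap ∘ₗ LinearMap.inr A N Q ∘ₗ k')
    refine ⟨H.rangeRestrict ∘ₗ g, G, fun u => ?_⟩
    show g u = (H ∘ₗ g + G ∘ₗ U.subtype) u
    refine hC₂.hom_ext φ (fun y => ?_) u
    have h1 : H (g y.val) = (ψ.symm (ε.symm ((ε (ψ (ePart.map φ g y))).1, 0))).val :=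
      hH' (ePart.map φ g y)
    have h2 : G y.val = (ψ.symm (ε.symm (0, (ε (ψ (ePart.map φ g y))).2))).val :=
      (hG (ePart.map φ U.subtype y)).trans
        (congrArg (fun q => (ψ.symm (ε.symm ((0 : N), q))).val) (hk' y))
    show g y.val = H (g y.val) + G y.val
    rw [h1, h2]
    have h3 : ψ.symm (ε.symm ((ε (ψ (ePart.map φ g y))).1, 0)) +
        ψ.symm (ε.symm (0, (ε (ψ (ePart.map φ g y))).2)) = ePart.map φ g y := by
      rw [← map_add, ← map_add, Prod.mk_add_mk, add_zero, zero_add, Prod.mk.eta,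
        LinearEquiv.symm_apply_apply, LinearEquiv.symm_apply_apply]
    exact (congrArg (ePart.val φ _) h3).symm

/-- Submodules of `c(M)` are coresolved by `add c(E)`. -/
lemma exists_coresolution (K : Type) [Field K] [Algebra K B] [Module.Finite K B]
    (hφ : ∀ b, ∃ a, φ.toHom a = e * b * e)
    {E M N Q : Type} [AddCommGroup E] [Module A E] [AddCommGroup M] [Module A M]
    [AddCommGroup N] [Module A N] [AddCommGroup Q] [Module A Q]
    (ε : E ≃ₗ[A] N × Q) (hQ : Module.Injective A Q)
    (hN : ∀ (X : Type) (_ : AddCommGroup X) (_ : Module A X), InGen A M X ↔ InAdd A N X)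
    {C : Type} [AddCommGroup C] [Module B C] [Module K C] [IsScalarTower K B C]
    [Module.Finite K C] (hC : IsIntermediateExtension φ E C)
    (hquot : ∀ (X : Type) [AddCommGroup X] [Module B X], IsStableMod B e X →
      ∀ U : Submodule B X, (∀ g : U →ₗ[B] C, ∃ g' : X →ₗ[B] C, ∀ u : U, g' u = g u) →
        IsStableMod B e (X ⧸ U))
    {X : Type} [AddCommGroup X] [Module B X] (hX : IsIntermediateExtension φ M X)
    (U : Submodule B X) :
    InAdd B C X ∧ ∃ (C₀ C₁ : Type) (_ : AddCommGroup C₀) (_ : Module B C₀)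
      (_ : AddCommGroup C₁) (_ : Module B C₁), InAdd B C C₀ ∧ InAdd B C C₁ ∧
        ∃ (f : U →ₗ[B] C₀) (g : C₀ →ₗ[B] C₁), IsShortExact B f g := by
  have hEN : InAdd A E N := inAdd_iff.2 ⟨1, fun _ => ε.symm.toLinearMap ∘ₗ LinearMap.inl A N Q,
    fun _ => LinearMap.fst A N Q ∘ₗ ε.toLinearMap, fun m => by simp⟩
  have hgen : ∀ {Y : Type} [AddCommGroup Y] [Module B Y], IsCostableMod B e Y →
      IsStableMod B e Y → InGen A M (ePart φ Y) → InAdd B C Y := fun hY hY' hM =>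
    IsIntermediateExtension.inAdd φ hφ (hEN.trans ((hN _ _ _).1 hM)) hC
      ⟨hY, hY', ⟨LinearEquiv.refl A _⟩⟩
  obtain ⟨hX₁, hX₂, ⟨ψ⟩⟩ := hX
  have hMX : InGen A M (ePart φ X) :=
    (InGen.refl M).of_surjective ψ.symm.toLinearMap ψ.symm.surjective
  have hCX : InAdd B C X := hgen hX₁ hX₂ hMX
  refine ⟨hCX, ?_⟩
  obtain ⟨V, hV, ⟨π, hπ⟩, hdec⟩ := exists_submodule_decomposition hφ ε hQ hC
  have hVst : IsStableMod B e V := hC.2.1.of_injective _ V.subtype_injective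
  have hMV : InGen A M (ePart φ V) :=
    ((hN _ _ _).2 (InAdd.refl N)).of_surjective π hπ
  have : Module.Finite B C := Module.Finite.of_restrictScalars_finite K B C
  have : Module.Finite B X := hCX.finite
  have : IsNoetherian K B := inferInstance
  have : IsNoetherianRing B := isNoetherian_of_tower K this
  have : Module.Finite B U := inferInstance
  have : Module.Finite K V :=
    Module.Finite.of_injective (V.subtype.restrictScalars K) V.subtype_injective
  obtain ⟨k, γ, hγ⟩ := exists_hom_generators K (R := B) U V
  let f : U →ₗ[B] X × (Fin k → V) := LinearMap.prod U.subtype (LinearMap.pi γ)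
  have hf : Injective f := fun u u' h => Subtype.ext (congrArg Prod.fst h)
  have hfext : ∀ g : U →ₗ[B] C, ∃ g' : X × (Fin k → V) →ₗ[B] C, ∀ u, g' (f u) = g u := by
    intro g
    obtain ⟨g₁, g₂, hg⟩ := hdec X hX₁ U g
    obtain ⟨c, hc⟩ := hγ g₁
    let s : (Fin k → V) →ₗ[B] C :=
      { toFun := fun v => ∑ i, algebraMap K B (c i) • (v i : C)
        map_add' := fun v w => by simp [smul_add, Finset.sum_add_distrib]
        map_smul' := fun b v => by
          rw [RingHom.id_apply, Finset.smul_sum]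
          refine Finset.sum_congr rfl fun i _ => ?_
          show algebraMap K B (c i) • b • (v i : C) = _
          rw [← mul_smul, ← mul_smul, Algebra.commutes] }
    refine ⟨g₂ ∘ₗ LinearMap.fst B _ _ + s ∘ₗ LinearMap.snd B _ _, fun u => ?_⟩
    show g₂ u + ∑ i, algebraMap K B (c i) • (γ i u : C) = g u
    rw [hg, hc, add_comm]
    simp [algebraMap_smul]
  have hC₀ : IsCostableMod B e (X × (Fin k → V)) := hX₁.prod_pi hV k
  have hC₀' : IsStableMod B e (X × (Fin k → V)) := hX₂.prod hVst.pi
  let ρ : M × (Fin k → N) →ₗ[A] ePart φ (X × (Fin k → V)) :=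
    { toFun := fun z => ⟨((ψ.symm z.1).val, fun i => (π (z.2 i)).val),
        Prod.ext (ψ.symm z.1).prop (funext fun i => (π (z.2 i)).prop)⟩
      map_add' := fun z w => Subtype.ext (Prod.ext
        (congrArg (ePart.val φ _) (map_add ψ.symm z.1 w.1))
        (funext fun i => congrArg (ePart.val φ _) (map_add π (z.2 i) (w.2 i))))
      map_smul' := fun a z => Subtype.ext (Prod.ext
        (congrArg (ePart.val φ _) (map_smul ψ.symm a z.1))
        (funext fun i => congrArg (ePart.val φ V) (map_smul π a (z.2 i)))) }
  have hρ : Surjective ρ := fun y => by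
    choose n hn using fun i => hπ ⟨y.val.2 i, congrFun (congrArg Prod.snd y.prop) i⟩
    refine ⟨(ψ ⟨y.val.1, congrArg Prod.fst y.prop⟩, n),
      Subtype.ext (Prod.ext ?_ (funext fun i => ?_))⟩
    · exact congrArg (ePart.val φ _) (ψ.symm_apply_apply _)
    · exact congrArg (ePart.val φ _) (hn i)
  have hMC₀ : InGen A M (ePart φ (X × (Fin k → V))) :=
    ((InGen.refl M).prod_pi ((hN _ _ _).2 (InAdd.refl N)) k).of_surjective ρ hρ
  have hst : IsStableMod B e ((X × (Fin k → V)) ⧸ LinearMap.range f) := by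
    refine hquot _ hC₀' _ fun g => ?_
    obtain ⟨g', hg'⟩ := hfext (g ∘ₗ f.rangeRestrict)
    refine ⟨g', ?_⟩
    rintro ⟨_, u, rfl⟩
    exact hg' u
  refine ⟨X × (Fin k → V), _ ⧸ LinearMap.range f, inferInstance, inferInstance, inferInstance,
    inferInstance, hgen hC₀ hC₀' hMC₀,
    hgen (hC₀.of_surjective _ (LinearMap.range f).mkQ_surjective) hst
      (hMC₀.of_surjective _ (ePart.map_surjective φ _ (LinearMap.range f).mkQ_surjective)),
    f, (LinearMap.range f).mkQ, hf, (LinearMap.range f).mkQ_surjective,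
    LinearMap.exact_map_mkQ_range f⟩

end

end GenFinitePaper

namespace GenFinitePaper

/-- Let `M` be a gen-finite `A`-module and `E = N ⊕ Q` a basic
cogenerator with `add N = gen M` and `Q` injective (so `E` is the direct sum of all
indecomposables in `gen M` together with the remaining indecomposable injectives).  Let
`B = End_Γ(T_P)ᵒᵖ` be the cogenerator-tilted algebra of `E` with special idempotent `e`
and intermediate extension `c : mod A → mod B`.  Then every `B`-submodule `U` of `c(M)`
fits into a short exact sequence `0 → U → C₀ → C₁ → 0` with `C₀, C₁ ∈ add c(E)`;
consequently `Ext^i_B(U, c(M)/U) = 0` for all `i > 0`. -/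
theorem submodules_of_intermediate_extension_coresolved
    (K A : Type) [Field K] [Ring A] [Algebra K A] [FiniteDimensional K A]
    (M : Type) [AddCommGroup M] [Module A M] (hMfin : Module.Finite A M)
    (hMgenfin : GenFinite A M)
    (E : Type) [AddCommGroup E] [Module A E] [Module K E] [IsScalarTower K A E]
    [FiniteDimensional K E]
    (hEbasic : IsBasic A E) (hEcogen : IsCogenerator A E)
    -- `E = N ⊕ Q` with `add N = gen M` and `Q` injective
    (N Q : Type) [AddCommGroup N] [Module A N] [AddCommGroup Q] [Module A Q]
    (hsplitE : Nonempty (E ≃ₗ[A] N × Q)) (hQinj : Module.Injective A Q)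
    (hN : ∀ (X : Type) (_ : AddCommGroup X) (_ : Module A X), InGen A M X ↔ InAdd A N X)
    -- `T` is the basic `P`-special tilting module over `Γ = End_A(E)ᵒᵖ`, and
    -- `B = End_Γ(T)ᵒᵖ` with special idempotent `e = op (i₀ ∘ p₀)`
    (T : Type) [AddCommGroup T] [Module (Module.End A E)ᵐᵒᵖ T]
    [Module K T] [IsScalarTower K (Module.End A E)ᵐᵒᵖ T] [FiniteDimensional K T]
    (hT : IsSpecialTilting (Module.End A E)ᵐᵒᵖ (ModuleDual K A E) T)
    (hTbasic : IsBasic (Module.End A E)ᵐᵒᵖ T)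
    (i₀ : ModuleDual K A E →ₗ[(Module.End A E)ᵐᵒᵖ] T)
    (p₀ : T →ₗ[(Module.End A E)ᵐᵒᵖ] ModuleDual K A E)
    (hsplit : p₀.comp i₀ = LinearMap.id)
    -- `cM = c(M)` and `cE = c(E)` are intermediate extensions of `M` and `E`
    (cM : Type) [AddCommGroup cM] [Module (Module.End (Module.End A E)ᵐᵒᵖ T)ᵐᵒᵖ cM]
    (hcM : IsIntermediateExtension (canonicalCornerMap K A E T i₀ p₀ hsplit) M cM)
    (cE : Type) [AddCommGroup cE] [Module (Module.End (Module.End A E)ᵐᵒᵖ T)ᵐᵒᵖ cE]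
    (hcE : IsIntermediateExtension (canonicalCornerMap K A E T i₀ p₀ hsplit) E cE) :
    ∀ U : Submodule (Module.End (Module.End A E)ᵐᵒᵖ T)ᵐᵒᵖ cM,
      (∃ (C₀ C₁ : Type) (_ : AddCommGroup C₀)
          (_ : Module (Module.End (Module.End A E)ᵐᵒᵖ T)ᵐᵒᵖ C₀)
          (_ : AddCommGroup C₁)
          (_ : Module (Module.End (Module.End A E)ᵐᵒᵖ T)ᵐᵒᵖ C₁),
        InAdd (Module.End (Module.End A E)ᵐᵒᵖ T)ᵐᵒᵖ cE C₀ ∧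
        InAdd (Module.End (Module.End A E)ᵐᵒᵖ T)ᵐᵒᵖ cE C₁ ∧
        ∃ (f : U →ₗ[(Module.End (Module.End A E)ᵐᵒᵖ T)ᵐᵒᵖ] C₀)
          (g : C₀ →ₗ[(Module.End (Module.End A E)ᵐᵒᵖ T)ᵐᵒᵖ] C₁),
          IsShortExact (Module.End (Module.End A E)ᵐᵒᵖ T)ᵐᵒᵖ f g) ∧
      ExtVanishAll (Module.End (Module.End A E)ᵐᵒᵖ T)ᵐᵒᵖ U (cM ⧸ U) := by
  have hproj := hEcogen.projective_dual K A
  obtain ⟨T₀, T₁, _, _, _, _, ⟨D⟩⟩ := hT.exists_tiltingData K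
  have hφ := hEcogen.exists_corner_eq K A i₀ p₀ hsplit
  have hB := D.isStableMod_self hsplit
  have hC := D.isIntermediateExtension_dual hsplit
  have hcEC := IsIntermediateExtension.inAdd _ hφ (InAdd.refl E) hcE hC
  have : Module.Finite K (ModuleDual K (Module.End A E)ᵐᵒᵖ T) :=
    inferInstanceAs (Module.Finite K (T →ₗ[K] K))
  obtain ⟨ε⟩ := hsplitE
  intro U
  obtain ⟨hCcM, C₀, C₁, _, _, _, _, hC₀, hC₁, f, g, hfg⟩ := exists_coresolution K hφ ε hQinj hN hC
    (fun X _ _ hX U hU => by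
      let : Module K X :=
        Module.compHom X (algebraMap K (Module.End (Module.End A E)ᵐᵒᵖ T)ᵐᵒᵖ)
      have : IsScalarTower K (Module.End (Module.End A E)ᵐᵒᵖ T)ᵐᵒᵖ X :=
        IsScalarTower.of_algebraMap_smul fun _ _ => rfl
      exact D.quotient_stable K hsplit hX U hU) hcM U
  have hext : ∀ {Z : Type} [AddCommGroup Z] [Module (Module.End (Module.End A E)ᵐᵒᵖ T)ᵐᵒᵖ Z],
      InAdd _ (ModuleDual K (Module.End A E)ᵐᵒᵖ T) Z →
      ∀ (Y : Type) [AddCommGroup Y] [Module (Module.End (Module.End A E)ᵐᵒᵖ T)ᵐᵒᵖ Y],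
        IsStableMod _ (MulOpposite.op (i₀.comp p₀)) Y → Ext1Vanish _ Y Z :=
    fun hZ Y _ _ hY => (D.ext1Vanish_dual K hsplit hY).of_inAdd_right hZ
  refine ⟨⟨C₀, C₁, _, _, _, _, hcEC.trans hC₀, hcEC.trans hC₁, f, g, hfg⟩, ?_⟩
  exact extVanishAll_of_stable hB
    (fun Y _ _ hY => ext1Vanish_quotient_of_stable hB hfg (hext hCcM) (hext hC₀) (hext hC₁) hY)
    (hcM.2.1.of_injective _ U.subtype_injective)

end GenFinitePaper
end
end

section
/- Let A be a finite-dimensional K-algebra, I a two-sided ideal of A, and M a gen-finite A-module. Then M/IM is a gen-finite A/I-module. -/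
/- Preliminary notions: `add`, `gen`, `cogen`, generators and cogenerators,
short exact sequences, basic modules, indecomposability. -/

noncomputable section

namespace GenFinitePaper

section Quotient

variable {A B : Type} [Ring A] [Ring B] {π : A →+* B}

theorem surjInv_smul {X : Type} [AddCommGroup X] [Module A X]
    (hπ : Function.Surjective π) (hX : ∀ a : A, π a = 0 → ∀ x : X, a • x = 0) (a : A) (x : X) :
    Function.surjInv hπ (π a) • x = a • x := by
  rw [← sub_eq_zero, ← sub_smul]
  exact hX _ (by rw [map_sub, Function.surjInv_eq hπ, sub_self]) x

/-- If `π : A →+* B` is surjective and `ker π` annihilates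
the `A`-module `X`, then `X` is a `B`-module. -/
abbrev moduleOfSurjective {X : Type} [AddCommGroup X] [Module A X]
    (hπ : Function.Surjective π) (hX : ∀ a : A, π a = 0 → ∀ x : X, a • x = 0) : Module B X :=
  letI : SMul B X := ⟨fun b x => Function.surjInv hπ b • x⟩
  Function.Surjective.moduleLeft π hπ (surjInv_smul hπ hX)

theorem moduleOfSurjective_smul {X : Type} [AddCommGroup X] [Module A X]
    (hπ : Function.Surjective π) (hX : ∀ a : A, π a = 0 → ∀ x : X, a • x = 0) (a : A) (x : X) :
    letI := moduleOfSurjective hπ hX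
    π a • x = a • x :=
  surjInv_smul hπ hX a x

variable {X Y : Type} [AddCommGroup X] [Module A X] [Module B X]
  [AddCommGroup Y] [Module A Y] [Module B Y]

/-- Along a surjection `π : A →+* B`, an `A`-linear map between `B`-modules is `B`-linear. -/
def extendLinear (hπ : Function.Surjective π) (hX : ∀ (a : A) (x : X), π a • x = a • x)
    (hY : ∀ (a : A) (y : Y), π a • y = a • y) (f : X →ₗ[A] Y) : X →ₗ[B] Y where
  toFun := f
  map_add' := f.map_add
  map_smul' b x := by
    obtain ⟨a, rfl⟩ := hπ b
    simp [hX, hY]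

/-- Restriction of a `B`-linear map along `π : A →+* B`. -/
def restrictLinear (hX : ∀ (a : A) (x : X), π a • x = a • x)
    (hY : ∀ (a : A) (y : Y), π a • y = a • y) (f : X →ₗ[B] Y) : X →ₗ[A] Y where
  toFun := f
  map_add' := f.map_add
  map_smul' a x := by
    rw [RingHom.id_apply, ← hX, f.map_smul, hY]

end Quotient

section Factor

variable {A : Type} [Ring A] {I : Submodule A A} {X N : Type} [AddCommGroup X] [Module A X]
  [AddCommGroup N] [Module A N]

/-- A linear map from `X ^ n` to a module annihilated by `I` factors through `(X / IX) ^ n`. -/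
theorem exists_factor_pi_quotient (hN : ∀ i ∈ I, ∀ y : N, i • y = 0) {IX : Submodule A X}
    (hIX : IX = Submodule.span A {x : X | ∃ i ∈ I, ∃ m : X, x = i • m})
    {n : ℕ} (p : (Fin n → X) →ₗ[A] N) :
    ∃ q : (Fin n → X ⧸ IX) →ₗ[A] N, ∀ v : Fin n → X, q (fun j => IX.mkQ (v j)) = p v := by
  have hle (f : X →ₗ[A] N) : IX ≤ LinearMap.ker f := by
    rw [hIX, Submodule.span_le]
    rintro _ ⟨i, hi, m, rfl⟩
    simp [hN i hi]
  refine ⟨LinearMap.lsum A (fun _ => X ⧸ IX) ℕ fun j =>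
    IX.liftQ (p ∘ₗ LinearMap.single A (fun _ => X) j) (hle _), fun v => ?_⟩
  simp only [LinearMap.lsum_apply, LinearMap.sum_apply, LinearMap.comp_apply,
    LinearMap.proj_apply, Submodule.mkQ_apply, Submodule.liftQ_apply, LinearMap.coe_single]
  rw [← map_sum, Finset.univ_sum_single]

end Factor

/-- If `I` is a two-sided ideal of a finite-dimensional `K`-algebra `A`
and `M` is a gen-finite `A`-module, then `M/IM` is a gen-finite `A/I`-module.  The
quotient algebra `A/I` is presented as a surjective ring homomorphism `π : A →+* B` with
kernel `I`, and `M/IM` as the quotient of `M` by the `A`-submodule generated by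
`{i • m | i ∈ I, m ∈ M}`, equipped with its induced `B`-module structure. -/
theorem genFinite_quotient
    (K A : Type) [Field K] [Ring A] [Algebra K A] [FiniteDimensional K A]
    (I : Submodule A A) (hI : ∀ x ∈ I, ∀ a : A, x * a ∈ I)
    (M : Type) [AddCommGroup M] [Module A M] (hMfin : Module.Finite A M)
    (hM : GenFinite A M)
    (B : Type) [Ring B] (π : A →+* B) (hπ : Function.Surjective π)
    (hker : ∀ a : A, π a = 0 ↔ a ∈ I)
    (IM : Submodule A M)
    (hIM : IM = Submodule.span A {x : M | ∃ i ∈ I, ∃ m : M, x = i • m})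
    [Module B (M ⧸ IM)] (hsmul : ∀ (a : A) (m : M ⧸ IM), π a • m = a • m) :
    GenFinite B (M ⧸ IM) := by
  obtain ⟨E, _, _, hEfin, hE⟩ := hM
  let IE : Submodule A E := Submodule.span A {x : E | ∃ i ∈ I, ∃ m : E, x = i • m}
  have hann : ∀ a : A, π a = 0 → ∀ x : E ⧸ IE, a • x = 0 := fun a ha x => by
    obtain ⟨e, rfl⟩ := IE.mkQ_surjective x
    rw [← map_smul, Submodule.mkQ_apply, Submodule.Quotient.mk_eq_zero]
    exact Submodule.subset_span ⟨a, (hker a).1 ha, e, rfl⟩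
  let _ : Module B (E ⧸ IE) := moduleOfSurjective hπ hann
  have hQ : ∀ (a : A) (x : E ⧸ IE), π a • x = a • x := moduleOfSurjective_smul hπ hann
  have pi_smul {n : ℕ} {Q : Type} [AddCommGroup Q] [Module A Q] [Module B Q]
      (h : ∀ (a : A) (x : Q), π a • x = a • x) (a : A) (v : Fin n → Q) : π a • v = a • v :=
    funext fun j => h a (v j)
  refine ⟨E ⧸ IE, inferInstance, inferInstance, ?_, fun N _ _ => ?_⟩
  · obtain ⟨s, hs⟩ := (inferInstance : Module.Finite A (E ⧸ IE))
    refine ⟨s, eq_top_iff.2 fun x _ => ?_⟩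
    have hx : x ∈ Submodule.span A (s : Set (E ⧸ IE)) := hs ▸ Submodule.mem_top
    induction hx using Submodule.span_induction with
    | mem x hx => exact Submodule.subset_span hx
    | zero => exact zero_mem _
    | add x y _ _ hx hy => exact add_mem (hx trivial) (hy trivial)
    | smul a x _ hx => exact hQ a x ▸ Submodule.smul_mem _ _ (hx trivial)
  let _ : Module A N := Module.compHom N π
  have hN : ∀ (a : A) (y : N), π a • y = a • y := fun _ _ => rfl
  have hIN : ∀ i ∈ I, ∀ y : N, i • y = 0 := fun i hi y => by
    rw [← hN, (hker i).2 hi, zero_smul]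
  constructor
  · rintro ⟨n, p, hp⟩
    obtain ⟨m, i, r, hri⟩ := (hE N).1 ⟨n, restrictLinear (pi_smul hsmul) hN p ∘ₗ
      IM.mkQ.compLeft (Fin n), hp.comp (IM.mkQ_surjective.comp_left)⟩
    obtain ⟨q, hq⟩ := exists_factor_pi_quotient hIN (IX := IE) rfl r
    refine ⟨m, extendLinear hπ hN (pi_smul hQ) (IE.mkQ.compLeft (Fin m) ∘ₗ i),
      extendLinear hπ (pi_smul hQ) hN q, LinearMap.ext fun y => ?_⟩
    exact (hq (i y)).trans (LinearMap.congr_fun hri y)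
  · rintro ⟨n, i, p, hpi⟩
    have hp : Function.Surjective p := fun y => ⟨i y, LinearMap.congr_fun hpi y⟩
    obtain ⟨m, r, hr⟩ := (hE (Fin n → E)).2 ⟨n, LinearMap.id, LinearMap.id, rfl⟩
    obtain ⟨q, hq⟩ := exists_factor_pi_quotient hIN hIM
      (restrictLinear (pi_smul hQ) hN p ∘ₗ IE.mkQ.compLeft (Fin n) ∘ₗ r)
    refine ⟨m, extendLinear hπ (pi_smul hsmul) hN q, fun y => ?_⟩
    obtain ⟨v, hv⟩ := (hp.comp (IE.mkQ_surjective.comp_left.comp hr)) y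
    exact ⟨fun j => IM.mkQ (v j), (hq v).trans hv⟩

end GenFinitePaper
end
end

section
/- Let A be a finite-dimensional K-algebra and e ∈ A an idempotent such that the projective module P = Ae is gen-finite. Then the algebra eAe ≅ End_A(P)^op is representation-finite. -/
/- Preliminary notions: `add`, `gen`, `cogen`, generators and cogenerators,
short exact sequences, basic modules, indecomposability. -/

noncomputable section

namespace GenFinitePaper

/-- The left ideal `Ae` generated by an element `e`, as a left submodule of `A`. -/
def leftIdealOf (A : Type) [Ring A] (e : A) : Submodule A A :=
  LinearMap.range
    ({ toFun := fun x => x * e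
       map_add' := fun x y => add_mul x y e
       map_smul' := fun a x => by simp [smul_eq_mul, mul_assoc] } : A →ₗ[A] A)

/-- Left modules over the opposite endomorphism ring of `P`: the functor `Hom_A(P, -)` takes
values in them, endomorphisms acting by precomposition. -/
instance homModule {A P M : Type} [Ring A] [AddCommGroup P] [Module A P]
    [AddCommGroup M] [Module A M] : Module (Module.End A P)ᵐᵒᵖ (P →ₗ[A] M) where
  smul b f := f.comp b.unop
  one_smul _ := rfl
  mul_smul _ _ _ := rfl
  smul_zero _ := LinearMap.zero_comp _
  smul_add _ _ _ := LinearMap.add_comp _ _ _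
  add_smul _ _ _ := LinearMap.comp_add _ _ _
  zero_smul _ := LinearMap.comp_zero _

section Hom

open Function

variable {A P M N : Type} [Ring A] [AddCommGroup P] [Module A P]
  [AddCommGroup M] [Module A M] [AddCommGroup N] [Module A N]

theorem op_smul_hom_apply (b : (Module.End A P)ᵐᵒᵖ) (f : P →ₗ[A] M) (x : P) :
    (b • f) x = f (b.unop x) := rfl

/-- The action of `Hom_A(P, -)` on morphisms. -/
def homMap (P : Type) [AddCommGroup P] [Module A P] (f : M →ₗ[A] N) :
    (P →ₗ[A] M) →ₗ[(Module.End A P)ᵐᵒᵖ] (P →ₗ[A] N) where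
  toFun h := f.comp h
  map_add' _ _ := LinearMap.comp_add _ _ _
  map_smul' _ _ := rfl

/-- `Hom_A(P, M ^ n)` is `Hom_A(P, M) ^ n`. -/
def homPiEquiv (A P M : Type) [Ring A] [AddCommGroup P] [Module A P]
    [AddCommGroup M] [Module A M] (n : ℕ) :
    (P →ₗ[A] (Fin n → M)) ≃ₗ[(Module.End A P)ᵐᵒᵖ] (Fin n → (P →ₗ[A] M)) where
  toFun h i := (LinearMap.proj i).comp h
  map_add' _ _ := rfl
  map_smul' _ _ := rfl
  invFun h := LinearMap.pi h
  left_inv _ := rfl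
  right_inv _ := rfl

/-- `Hom_A(P, P)` is the regular module of `End_A(P)ᵒᵖ`. -/
def homSelfEquiv (A P : Type) [Ring A] [AddCommGroup P] [Module A P] :
    (Module.End A P)ᵐᵒᵖ ≃ₗ[(Module.End A P)ᵐᵒᵖ] (P →ₗ[A] P) where
  toFun b := b.unop
  map_add' _ _ := rfl
  map_smul' _ _ := rfl
  invFun h := MulOpposite.op h
  left_inv _ := rfl
  right_inv _ := rfl

/-- `Hom_A(P, P ^ n)` is the free module of rank `n` over `End_A(P)ᵒᵖ`. -/
def homFreeEquiv (A P : Type) [Ring A] [AddCommGroup P] [Module A P] (n : ℕ) :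
    (Fin n → (Module.End A P)ᵐᵒᵖ) ≃ₗ[(Module.End A P)ᵐᵒᵖ] (P →ₗ[A] (Fin n → P)) :=
  (LinearEquiv.piCongrRight fun _ => homSelfEquiv A P).trans (homPiEquiv A P P n).symm

theorem InAdd.hom (h : InAdd A M N) :
    InAdd (Module.End A P)ᵐᵒᵖ (P →ₗ[A] M) (P →ₗ[A] N) := by
  obtain ⟨n, i, p, hip⟩ := h
  refine ⟨n, (homPiEquiv A P M n).toLinearMap.comp (homMap P i),
    (homMap P p).comp (homPiEquiv A P M n).symm.toLinearMap, ?_⟩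
  ext h x
  exact LinearMap.congr_fun hip (h x)

theorem InAdd.of_equiv {M' : Type} [AddCommGroup M'] [Module A M'] (φ : M' ≃ₗ[A] M)
    (h : InAdd A N M) : InAdd A N M' := by
  obtain ⟨n, i, p, hip⟩ := h
  refine ⟨n, i.comp φ.toLinearMap, φ.symm.toLinearMap.comp p, ?_⟩
  ext x
  have := LinearMap.congr_fun hip (φ x)
  simp only [LinearMap.comp_apply, LinearMap.id_apply] at this
  simp [this]

theorem InAdd.refl_s18 : InAdd A M M :=
  ⟨1, LinearMap.pi fun _ => LinearMap.id, LinearMap.proj 0, rfl⟩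

theorem homMap_surjective [Module.Projective A P] {f : M →ₗ[A] N} (hf : Surjective f) :
    Surjective (homMap P f) :=
  fun h => Module.projective_lifting_property f h hf

theorem InGen.finite_hom [Module.Projective A P] (h : InGen A P M) :
    Module.Finite (Module.End A P)ᵐᵒᵖ (P →ₗ[A] M) := by
  obtain ⟨n, p, hp⟩ := h
  exact Module.Finite.of_surjective ((homMap P p).comp (homFreeEquiv A P n).toLinearMap)
    ((homMap_surjective hp).comp (homFreeEquiv A P n).surjective)

/-- The submodule of `P ^ n` generated by the images of the morphisms `P → P ^ n` in `L`. -/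
def traceSubmodule {n : ℕ} (L : Submodule (Module.End A P)ᵐᵒᵖ (P →ₗ[A] (Fin n → P))) :
    Submodule A (Fin n → P) :=
  ⨆ f : L, LinearMap.range f.1

/-- A set of morphisms from a finitely generated projective module that is closed under
precomposition with endomorphisms contains every morphism into the sum of its images. -/
theorem mem_of_range_le_traceSubmodule [Module.Projective A P] [Module.Finite A P] {n : ℕ}
    (L : Submodule (Module.End A P)ᵐᵒᵖ (P →ₗ[A] (Fin n → P)))
    {h : P →ₗ[A] (Fin n → P)} (hh : ∀ x, h x ∈ traceSubmodule L) : h ∈ L := by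
  classical
  obtain ⟨s, hs⟩ := CompleteLattice.IsCompactElement.exists_finset_of_le_iSup
    (Submodule A (Fin n → P)) ((Submodule.fg_iff_compact _).1 (Module.Finite.fg_top.map h))
    (fun f : L => LinearMap.range f.1) (by
      rintro _ ⟨x, -, rfl⟩
      exact hh x)
  let g : (s → P) →ₗ[A] (Fin n → P) := ∑ f : s, f.1.1.comp (LinearMap.proj f)
  have hg : ∀ x, h x ∈ LinearMap.range g := by
    intro x
    refine (hs.trans (iSup₂_le fun f hf => ?_)) (Submodule.mem_map_of_mem trivial)
    rintro _ ⟨y, rfl⟩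
    refine ⟨Pi.single ⟨f, hf⟩ y, ?_⟩
    simp only [g, LinearMap.sum_apply, LinearMap.comp_apply, LinearMap.proj_apply]
    rw [Finset.sum_eq_single ⟨f, hf⟩]
    · simp
    · intro b _ hb
      simp [Pi.single_eq_of_ne hb]
    · simp
  obtain ⟨k, hk⟩ := Module.projective_lifting_property g.rangeRestrict (h.codRestrict _ hg)
    g.surjective_rangeRestrict
  have hgk : h = ∑ f : s, MulOpposite.op ((LinearMap.proj f).comp k) • f.1.1 := by
    ext1 x
    have := congrArg Subtype.val (LinearMap.congr_fun hk x)
    change g (k x) = h x at this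
    rw [← this]
    simp [g, op_smul_hom_apply]
  rw [hgk]
  exact Submodule.sum_mem _ fun f _ => L.smul_mem _ f.1.2

theorem ker_homMap_mkQ_traceSubmodule [Module.Projective A P] [Module.Finite A P] {n : ℕ}
    (L : Submodule (Module.End A P)ᵐᵒᵖ (P →ₗ[A] (Fin n → P))) :
    LinearMap.ker (homMap P (traceSubmodule L).mkQ) = L := by
  ext h
  have key : h ∈ LinearMap.ker (homMap P (traceSubmodule L).mkQ) ↔
      ∀ x, h x ∈ traceSubmodule L := by
    simp [homMap, LinearMap.ext_iff]
  rw [key]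
  exact ⟨mem_of_range_le_traceSubmodule L, fun hL x =>
    le_iSup (fun f : L => LinearMap.range f.1) ⟨h, hL⟩ ⟨x, rfl⟩⟩

/-- Every finitely generated `End_A(P)ᵒᵖ`-module is of the form `Hom_A(P, M)` with `M` in
`gen P`. -/
theorem exists_inGen_equiv_hom [Module.Projective A P] [Module.Finite A P]
    (X : Type) [AddCommGroup X] [Module (Module.End A P)ᵐᵒᵖ X]
    [Module.Finite (Module.End A P)ᵐᵒᵖ X] :
    ∃ (M : Type) (_ : AddCommGroup M) (_ : Module A M), InGen A P M ∧
      Nonempty (X ≃ₗ[(Module.End A P)ᵐᵒᵖ] (P →ₗ[A] M)) := by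
  obtain ⟨n, q, hq⟩ := Module.Finite.exists_fin' (Module.End A P)ᵐᵒᵖ X
  let q' := q.comp (homFreeEquiv A P n).symm.toLinearMap
  have hq' : Surjective q' := hq.comp (homFreeEquiv A P n).symm.surjective
  let U := traceSubmodule (LinearMap.ker q')
  exact ⟨(Fin n → P) ⧸ U, inferInstance, inferInstance, ⟨n, U.mkQ, U.mkQ_surjective⟩,
    ⟨(q'.quotKerEquivOfSurjective hq').symm.trans
      ((Submodule.quotEquivOfEq _ _ (ker_homMap_mkQ_traceSubmodule _).symm).trans
        ((homMap P U.mkQ).quotKerEquivOfSurjective (homMap_surjective U.mkQ_surjective)))⟩⟩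

/-- The opposite endomorphism ring of a finitely generated projective gen-finite module is
representation-finite. -/
theorem GenFinite.repFinite_end_op [Module.Projective A P] [Module.Finite A P]
    (h : GenFinite A P) : RepFinite (Module.End A P)ᵐᵒᵖ := by
  obtain ⟨E, _, _, -, hE⟩ := h
  refine ⟨P →ₗ[A] E, inferInstance, inferInstance, ((hE E).2 InAdd.refl_s18).finite_hom, ?_⟩
  intro X _ _ _
  obtain ⟨M, _, _, hM, ⟨φ⟩⟩ := exists_inGen_equiv_hom (A := A) (P := P) X
  exact ((hE M).1 hM).hom.of_equiv φ

end Hom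

section LeftIdeal

variable {A : Type} [Ring A]

instance leftIdealOf_finite (e : A) : Module.Finite A (leftIdealOf A e) :=
  Module.Finite.range _

theorem mul_eq_of_mem_leftIdealOf {e : A} (he : e * e = e) {x : A} (hx : x ∈ leftIdealOf A e) :
    x * e = x := by
  obtain ⟨y, rfl⟩ := hx
  change y * e * e = y * e
  rw [mul_assoc, he]

theorem leftIdealOf_projective {e : A} (he : e * e = e) :
    Module.Projective A (leftIdealOf A e) := by
  refine Module.Projective.of_split (leftIdealOf A e).subtype (LinearMap.rangeRestrict _) ?_
  ext x
  exact mul_eq_of_mem_leftIdealOf he x.2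

end LeftIdeal

/-- Let `A` be a finite-dimensional `K`-algebra and `e ∈ A` an idempotent
such that the projective module `P = Ae` is gen-finite.  Then the algebra
`eAe ≅ End_A(P)ᵒᵖ` is representation-finite. -/
theorem repFinite_corner_of_genFinite_projective
    (K A : Type) [Field K] [Ring A] [Algebra K A] [FiniteDimensional K A]
    (e : A) (he : e * e = e)
    (hgen : GenFinite A (leftIdealOf A e)) :
    RepFinite (Module.End A (leftIdealOf A e))ᵐᵒᵖ := by
  have := leftIdealOf_projective he
  exact hgen.repFinite_end_op

end GenFinitePaper
end
end
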